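/- arXiv:0709.0035 — 6 statements merged into one kernel-verified Lean document; each statement's English description precedes it below -/
import Mathlib

section
/- Let H be an N×M random matrix (M ≤ N) whose entries are i.i.d. circularly-symmetric complex Gaussian with mean zero and unit variance, with singular values σ₁ ≤ σ₂ ≤ … ≤ σ_M. For any exponents b₁ ≥ b₂ ≥ … ≥ b_M > 0, lim_{ε→0+} log Pr{σ₁ ≤ ε^{b₁}, σ₂ ≤ ε^{b₂}, …, σ_M ≤ ε^{b_M}} / log ε = Σ_{i=1}^{M} 2(N−M+2i−1) b_i. -/
open MeasureTheory ProbabilityTheory Matrix Filter Set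

noncomputable section

/-- Euclidean norm of a complex vector indexed by a finite type. -/
def cnorm {ι : Type*} [Fintype ι] (v : ι → ℂ) : ℝ :=
  Real.sqrt (∑ i, ‖v i‖ ^ 2)

/-- Minimum distance of the complex lattice generated by the columns of `G`
(over the Gaussian integers): `d(G) = inf {‖G z‖ : z ∈ ℤ[i]^κ, z ≠ 0}`. -/
def latMinDist {ι κ : Type*} [Fintype ι] [Fintype κ] (G : Matrix ι κ ℂ) : ℝ :=
  sInf {r | ∃ z : κ → GaussianInt, z ≠ 0 ∧ r = cnorm (G.mulVec fun j => (z j : ℂ))}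

/-- Sample space measure for an `N × M` i.i.d. circularly-symmetric complex Gaussian
matrix of unit entry variance: each of the `2NM` real coordinates is an independent
real Gaussian of mean `0` and variance `1/2`. -/
def gaussMatMeasure (N M : ℕ) : Measure ((Fin N × Fin M × Bool) → ℝ) :=
  Measure.pi fun _ => gaussianReal 0 (1/2)

/-- The complex matrix built from a sample of real coordinates
(`false` ↦ real part, `true` ↦ imaginary part). -/
def matOf {N M : ℕ} (g : (Fin N × Fin M × Bool) → ℝ) : Matrix (Fin N) (Fin M) ℂ :=
  fun i j => (g (i, j, false) : ℂ) + (g (i, j, true) : ℂ) * Complex.I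

def mv {N M : ℕ} (H : Fin N → Fin M → ℂ) (v : Fin M → ℂ) : Fin N → ℂ :=
  fun i => ∑ j, H i j * v j

def SSmall {N M : ℕ} (H : Fin N → Fin M → ℂ) (k : ℕ) (s : ℝ) : Prop :=
  ∃ V : Submodule ℂ (Fin M → ℂ), k ≤ Module.finrank ℂ V ∧ ∀ v ∈ V, ‖mv H v‖ ≤ s * ‖v‖

def AA (N M : ℕ) (t : Fin M → ℝ) : Set (Fin N → Fin M → ℂ) :=
  {H | ∀ i : Fin M, SSmall H ((i : ℕ) + 1) (t i)}

def schur {N M : ℕ} (p : Fin (N+1)) (q : Fin (M+1)) (H : Fin (N+1) → Fin (M+1) → ℂ) :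
    Fin N → Fin M → ℂ :=
  fun i j => H (p.succAbove i) (q.succAbove j)
    - H (p.succAbove i) q * (H p q)⁻¹ * H p (q.succAbove j)

lemma mv_le {N M : ℕ} (H : Fin N → Fin M → ℂ) (c : ℝ) (hc : 0 ≤ c)
    (h : ∀ i j, ‖H i j‖ ≤ c) (v : Fin M → ℂ) : ‖mv H v‖ ≤ M * c * ‖v‖ := by
  rw [pi_norm_le_iff_of_nonneg (by positivity)]
  intro i
  refine (norm_sum_le _ _).trans ?_
  calc ∑ j, ‖H i j * v j‖ ≤ ∑ _j : Fin M, c * ‖v‖ := by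
        refine Finset.sum_le_sum fun j _ => ?_
        rw [norm_mul]
        exact mul_le_mul (h i j) (norm_le_pi_norm v j) (norm_nonneg _) hc
    _ = M * c * ‖v‖ := by simp; ring

lemma SSmall.entry {N M : ℕ} {H : Fin N → Fin M → ℂ} {s : ℝ} (h : SSmall H M s) (i : Fin N)
    (j : Fin M) : ‖H i j‖ ≤ s := by
  obtain ⟨V, hV, h⟩ := h
  have hT : V = ⊤ := by
    apply Submodule.eq_top_of_finrank_eq
    apply le_antisymm (Submodule.finrank_le V)
    simpa using hV
  have h1 := h (Pi.single j 1) (by simp [hT])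
  have h2 := norm_le_pi_norm (mv H (Pi.single j 1)) i
  have h3 : mv H (Pi.single j 1) i = H i j := by
    simp [mv, Pi.single_apply]
  rw [h3] at h2
  refine h2.trans (h1.trans ?_)
  simp [Pi.norm_single]

lemma finrank_map_le_of_injOn {m n : ℕ} (f : (Fin m → ℂ) →ₗ[ℂ] (Fin n → ℂ))
    (V : Submodule ℂ (Fin m → ℂ)) (h : ∀ v ∈ V, f v = 0 → v = 0) :
    Module.finrank ℂ V ≤ Module.finrank ℂ (V.map f) := by
  refine LinearMap.finrank_le_finrank_of_injective (f := f.submoduleMap V) ?_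
  rw [← LinearMap.ker_eq_bot, LinearMap.ker_eq_bot']
  rintro ⟨v, hv⟩ h0
  have : f v = 0 := congrArg Subtype.val h0
  exact Subtype.ext (h v hv this)

lemma schur_mv {N M : ℕ} (p : Fin (N+1)) (q : Fin (M+1)) (H : Fin (N+1) → Fin (M+1) → ℂ)
    (ha : H p q ≠ 0) (v : Fin (M+1) → ℂ) (i : Fin N) :
    mv (schur p q H) (fun j => v (q.succAbove j)) i =
      mv H v (p.succAbove i) - H (p.succAbove i) q * (H p q)⁻¹ * mv H v p := by
  simp only [mv, schur, Fin.sum_univ_succAbove _ q, sub_mul, Finset.sum_sub_distrib]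
  rw [mul_add, Finset.mul_sum]
  have : H (p.succAbove i) q * (H p q)⁻¹ * (H p q * v q) = H (p.succAbove i) q * v q := by
    field_simp
  rw [this]
  simp only [mul_assoc]
  ring

/-- forget coordinate `q` -/
def proj {M : ℕ} (q : Fin (M+1)) : (Fin (M+1) → ℂ) →ₗ[ℂ] (Fin M → ℂ) :=
  LinearMap.funLeft ℂ ℂ q.succAbove

lemma proj_apply {M : ℕ} (q : Fin (M+1)) (v : Fin (M+1) → ℂ) :
    proj q v = fun j => v (q.succAbove j) := rfl

lemma norm_succAbove_le {M : ℕ} (q : Fin (M+1)) (v : Fin (M+1) → ℂ) {c : ℝ} (h : ‖v q‖ ≤ c)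
    (h' : ‖proj q v‖ ≤ c) : ‖v‖ ≤ c := by
  rw [pi_norm_le_iff_of_nonneg ((norm_nonneg _).trans h)]
  intro i
  rcases Fin.eq_self_or_eq_succAbove q i with rfl | ⟨j, rfl⟩
  · exact h
  · exact (norm_le_pi_norm (proj q v) j).trans h'

lemma SSmall.schur {N M : ℕ} (p : Fin (N+1)) (q : Fin (M+1)) (H : Fin (N+1) → Fin (M+1) → ℂ)
    (hp : ∀ i j, ‖H i j‖ ≤ ‖H p q‖) {k : ℕ} (hk : k ≤ M) {s : ℝ} (hs : 0 < s)
    (h : SSmall H k s) : SSmall (schur p q H) k ((4 * M + 2) * s) := by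
  have hcd : ∀ i j, ‖H i q * (H p q)⁻¹ * H p j‖ ≤ ‖H p q‖ := by
    intro i j
    by_cases ha : H p q = 0
    · simp [ha]
    have : 0 < ‖H p q‖ := norm_pos_iff.mpr ha
    rw [norm_mul, norm_mul, norm_inv, ← div_eq_mul_inv]
    calc _ ≤ 1 * ‖H p q‖ := by
          gcongr
          · exact div_le_one_of_le₀ (hp _ _) (norm_nonneg _)
          · exact hp _ _
      _ = _ := one_mul _
  by_cases hsa : ‖H p q‖ ≤ 2 * s
  · refine ⟨⊤, by simpa using hk, fun v _ => ?_⟩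
    refine (mv_le _ (2 * ‖H p q‖) (by positivity) ?_ v).trans ?_
    · intro i j
      refine (norm_sub_le _ _).trans ?_
      have := hp (p.succAbove i) (q.succAbove j)
      have := hcd (p.succAbove i) (q.succAbove j)
      linarith
    · refine mul_le_mul_of_nonneg_right ?_ (norm_nonneg _)
      have : (M : ℝ) * (2 * ‖H p q‖) ≤ M * (2 * (2 * s)) := by gcongr
      nlinarith
  push Not at hsa
  have ha' : 0 < ‖H p q‖ := by linarith
  have ha : H p q ≠ 0 := norm_pos_iff.mp ha'
  obtain ⟨V, hV, h⟩ := h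
  have key : ∀ v ∈ V, ‖v‖ ≤ (2 * M + 1) * ‖proj q v‖ := by
    intro v hv
    have h1 := h v hv
    have h2 : ‖mv H v p‖ ≤ s * ‖v‖ := (norm_le_pi_norm _ _).trans h1
    have h3 : H p q * v q = mv H v p - ∑ j, H p (q.succAbove j) * v (q.succAbove j) := by
      simp [mv, Fin.sum_univ_succAbove _ q]
    have h4 : ‖∑ j, H p (q.succAbove j) * v (q.succAbove j)‖ ≤ M * (‖H p q‖ * ‖proj q v‖) := by
      refine (norm_sum_le _ _).trans ?_
      calc _ ≤ ∑ _j : Fin M, ‖H p q‖ * ‖proj q v‖ := by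
            refine Finset.sum_le_sum fun j _ => ?_
            rw [norm_mul]
            exact mul_le_mul (hp _ _) (norm_le_pi_norm (proj q v) j) (norm_nonneg _) (norm_nonneg _)
        _ = _ := by simp
    have h5 : ‖H p q‖ * ‖v q‖ ≤ s * ‖v‖ + M * (‖H p q‖ * ‖proj q v‖) := by
      rw [← norm_mul, h3]
      exact (norm_sub_le _ _).trans (add_le_add h2 h4)
    have h6 : ‖v q‖ ≤ ‖v‖ / 2 + M * ‖proj q v‖ := by
      have : s * ‖v‖ ≤ ‖H p q‖ / 2 * ‖v‖ := by gcongr; linarith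
      have : ‖H p q‖ * ‖v q‖ ≤ ‖H p q‖ * (‖v‖ / 2 + M * ‖proj q v‖) := by linarith
      exact le_of_mul_le_mul_left this ha'
    have hpn := norm_nonneg (proj q v)
    by_cases h7 : ‖v q‖ ≤ ‖proj q v‖
    · have := norm_succAbove_le q v h7 le_rfl
      have : 0 ≤ (M:ℝ) * ‖proj q v‖ := by positivity
      linarith
    · have := norm_succAbove_le q v le_rfl (not_le.mp h7).le
      linarith
  refine ⟨V.map (proj q), ?_, ?_⟩
  · refine hV.trans (finrank_map_le_of_injOn _ _ fun v hv h0 => ?_)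
    have := key v hv
    rw [h0, norm_zero, mul_zero] at this
    exact norm_le_zero_iff.mp this
  · rintro _ ⟨v, hv, rfl⟩
    have h1 := h v hv
    have h2 := key v hv
    calc ‖mv (_root_.schur p q H) (proj q v)‖ ≤ 2 * ‖mv H v‖ := by
          rw [pi_norm_le_iff_of_nonneg (by positivity)]
          intro i
          rw [proj_apply, schur_mv p q H ha]
          refine (norm_sub_le _ _).trans ?_
          have e1 := norm_le_pi_norm (mv H v) (p.succAbove i)
          have e2 := norm_le_pi_norm (mv H v) p
          have e3 : ‖H (p.succAbove i) q * (H p q)⁻¹ * mv H v p‖ ≤ 1 * ‖mv H v‖ := by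
            rw [norm_mul, norm_mul, norm_inv, ← div_eq_mul_inv]
            gcongr
            exact div_le_one_of_le₀ (hp _ _) (norm_nonneg _)
          linarith
      _ ≤ 2 * (s * ((2 * M + 1) * ‖proj q v‖)) := by
          refine mul_le_mul_of_nonneg_left (h1.trans ?_) (by norm_num)
          exact mul_le_mul_of_nonneg_left h2 hs.le
      _ = _ := by ring

lemma SSmall.of_schur {N M : ℕ} (p : Fin (N+1)) (q : Fin (M+1)) (H : Fin (N+1) → Fin (M+1) → ℂ)
    (ha : H p q ≠ 0) {k : ℕ} {s : ℝ} (hs : 0 < s)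
    (h : SSmall (_root_.schur p q H) k s) : SSmall H k s := by
  obtain ⟨W, hW, h⟩ := h
  let L : (Fin M → ℂ) →ₗ[ℂ] (Fin (M+1) → ℂ) :=
    { toFun := fun w => q.insertNth (-(H p q)⁻¹ * ∑ j, H p (q.succAbove j) * w j) w
      map_add' := by
        intro x y
        ext i
        rcases Fin.eq_self_or_eq_succAbove q i with rfl | ⟨j, rfl⟩
        · simp [mul_add, Finset.sum_add_distrib]
        · simp
      map_smul' := by
        intro c x
        ext i
        rcases Fin.eq_self_or_eq_succAbove q i with rfl | ⟨j, rfl⟩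
        · simp only [Fin.insertNth_apply_same, Pi.smul_apply, smul_eq_mul, RingHom.id_apply,
            Finset.mul_sum]
          refine Finset.sum_congr rfl fun j _ => ?_
          ring
        · simp }
  have hL1 : ∀ w, proj q (L w) = w := by
    intro w; ext j; simp [proj_apply, L]
  have hL2 : ∀ w, mv H (L w) p = 0 := by
    intro w
    simp only [mv, Fin.sum_univ_succAbove _ q, L, LinearMap.coe_mk, AddHom.coe_mk,
      Fin.insertNth_apply_same, Fin.insertNth_apply_succAbove]
    field_simp
    ring
  have hinj : Function.Injective L := fun x y hxy => by
    rw [← hL1 x, ← hL1 y, hxy]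
  refine ⟨W.map L, ?_, ?_⟩
  · refine hW.trans (finrank_map_le_of_injOn _ _ fun v hv h0 => ?_)
    exact hinj (by rw [h0, map_zero])
  · rintro _ ⟨w, hw, rfl⟩
    have h1 := h w hw
    have h2 : ‖mv H (L w)‖ ≤ ‖mv (_root_.schur p q H) w‖ := by
      rw [pi_norm_le_iff_of_nonneg (norm_nonneg _)]
      intro i
      rcases Fin.eq_self_or_eq_succAbove p i with rfl | ⟨j, rfl⟩
      · rw [hL2]; simp
      · have := schur_mv p q H ha (L w) j
        rw [← proj_apply, hL1, hL2, mul_zero, sub_zero] at this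
        rw [← this]
        exact norm_le_pi_norm _ _
    refine h2.trans (h1.trans ?_)
    refine mul_le_mul_of_nonneg_left ?_ hs.le
    rw [pi_norm_le_iff_of_nonneg (norm_nonneg _)]
    intro j
    have := norm_le_pi_norm (L w) (q.succAbove j)
    rwa [show L w (q.succAbove j) = w j from congrFun (hL1 w) j] at this

/-- split off row `p` and column `q` -/
def splitE (N M : ℕ) (p : Fin (N+1)) (q : Fin (M+1)) :
    (Fin (N+1) → Fin (M+1) → ℂ) ≃ᵐ
      ((ℂ × (Fin M → ℂ)) × (Fin N → ℂ)) × (Fin N → Fin M → ℂ) :=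
  (((MeasurableEquiv.piFinSuccAbove (fun _ => Fin (M+1) → ℂ) p).trans
    (MeasurableEquiv.prodCongr (MeasurableEquiv.piFinSuccAbove (fun _ => ℂ) q)
      ((MeasurableEquiv.piCongrRight
        (fun _ : Fin N => MeasurableEquiv.piFinSuccAbove (fun _ => ℂ) q)).trans
        (MeasurableEquiv.arrowProdEquivProdArrow ℂ (Fin M → ℂ) (Fin N))))).trans
    MeasurableEquiv.prodAssoc.symm)

lemma splitE_apply {N M : ℕ} (p : Fin (N+1)) (q : Fin (M+1)) (H) :
    splitE N M p q H = (((H p q, fun j => H p (q.succAbove j)), fun i => H (p.succAbove i) q),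
      fun i j => H (p.succAbove i) (q.succAbove j)) := rfl

lemma splitE_mp {N M : ℕ} (p : Fin (N+1)) (q : Fin (M+1)) :
    MeasurePreserving (splitE N M p q) volume volume := by
  have h1 := volume_preserving_piFinSuccAbove (fun _ => Fin (M+1) → ℂ) p
  have h2 := volume_preserving_piFinSuccAbove (fun _ : Fin (M+1) => ℂ) q
  have h3 : MeasurePreserving (MeasurableEquiv.piCongrRight
        (fun _ : Fin N => MeasurableEquiv.piFinSuccAbove (fun _ : Fin (M+1) => ℂ) q)) :=
    volume_preserving_pi (fun _ : Fin N => h2)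
  have h4 := volume_measurePreserving_arrowProdEquivProdArrow ℂ (Fin M → ℂ) (Fin N)
  have h5 := h2.prod (h4.comp h3)
  have h6 := (volume_preserving_prodAssoc (α₁ := ℂ × (Fin M → ℂ)) (β₁ := Fin N → ℂ)
    (γ₁ := Fin N → Fin M → ℂ)).symm
  exact h6.comp (h5.comp h1)

abbrev shearF {N M : ℕ} (x : (ℂ × (Fin M → ℂ)) × (Fin N → ℂ)) : Fin N → Fin M → ℂ :=
  fun i j => x.2 i * x.1.1⁻¹ * x.1.2 j

lemma shearF_meas {N M : ℕ} : Measurable (shearF (N := N) (M := M)) := by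
  unfold shearF
  refine measurable_pi_lambda _ fun i => measurable_pi_lambda _ fun j => ?_
  fun_prop

def shearE (N M : ℕ) : ((ℂ × (Fin M → ℂ)) × (Fin N → ℂ)) × (Fin N → Fin M → ℂ) ≃ᵐ
      ((ℂ × (Fin M → ℂ)) × (Fin N → ℂ)) × (Fin N → Fin M → ℂ) where
  toFun x := (x.1, x.2 - shearF x.1)
  invFun x := (x.1, x.2 + shearF x.1)
  left_inv x := by simp
  right_inv x := by simp
  measurable_toFun := by
    exact measurable_fst.prodMk (measurable_snd.sub (shearF_meas.comp measurable_fst))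
  measurable_invFun := by
    exact measurable_fst.prodMk (measurable_snd.add (shearF_meas.comp measurable_fst))

lemma shearE_mp (N M : ℕ) : MeasurePreserving (shearE N M) volume volume := by
  refine MeasurePreserving.skew_product (f := id) (MeasurePreserving.id _)
    (g := fun x y => y - shearF x) ?_ ?_
  · exact measurable_snd.sub (shearF_meas.comp measurable_fst)
  · refine Eventually.of_forall fun x => ?_
    exact (measurePreserving_sub_right volume (shearF x)).map_eq

lemma vol_pivot {N M : ℕ} (p : Fin (N+1)) (q : Fin (M+1)) (A : Set ℂ) (R : Set (Fin M → ℂ))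
    (C : Set (Fin N → ℂ)) (S : Set (Fin N → Fin M → ℂ)) :
    volume {H : Fin (N+1) → Fin (M+1) → ℂ | H p q ∈ A ∧ (fun j => H p (q.succAbove j)) ∈ R ∧
      (fun i => H (p.succAbove i) q) ∈ C ∧ schur p q H ∈ S} =
    volume A * volume R * volume C * volume S := by
  have h := ((shearE_mp N M).comp (splitE_mp p q)).measure_preimage_equiv
    (f := (splitE N M p q).trans (shearE N M)) (((A ×ˢ R) ×ˢ C) ×ˢ S)
  have e : volume (((A ×ˢ R) ×ˢ C) ×ˢ S) = volume A * volume R * volume C * volume S := by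
    simp only [Measure.volume_eq_prod, Measure.prod_prod]
  rw [← e, ← h]
  congr 1
  ext H
  simp only [mem_preimage, mem_ofPred_eq, MeasurableEquiv.trans_apply, splitE_apply]
  constructor
  · rintro ⟨h1, h2, h3, h4⟩
    exact ⟨⟨⟨h1, h2⟩, h3⟩, h4⟩
  · rintro ⟨⟨⟨h1, h2⟩, h3⟩, h4⟩
    exact ⟨h1, h2, h3, h4⟩

lemma vol_ball_pi (n : ℕ) {r : ℝ} (hr : 0 ≤ r) :
    volume (Metric.closedBall (0 : Fin n → ℂ) r) = ENNReal.ofReal ((Real.pi * r ^ 2) ^ n) := by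
  rw [volume_pi_closedBall _ hr]
  simp only [Complex.volume_closedBall, Finset.prod_const, Finset.card_univ, Fintype.card_fin]
  rw [ENNReal.ofReal_pow (by positivity), ENNReal.ofReal_mul (by positivity),
    ENNReal.ofReal_pow hr, mul_comm, ← NNReal.coe_real_pi, ENNReal.ofReal_coe_nnreal]

lemma vol_ball (a : ℂ) {r : ℝ} (hr : 0 ≤ r) :
    volume (Metric.closedBall a r) = ENNReal.ofReal (Real.pi * r ^ 2) := by
  rw [Complex.volume_closedBall]
  rw [ENNReal.ofReal_mul (by positivity),
    ENNReal.ofReal_pow hr, mul_comm, ← NNReal.coe_real_pi, ENNReal.ofReal_coe_nnreal]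

lemma upper_step (N M : ℕ) (t : Fin (M+1) → ℝ) (ht : ∀ i, 0 < t i) :
    volume (AA (N+1) (M+1) t) ≤ ENNReal.ofReal ((N+1) * (M+1) *
      (Real.pi * t (Fin.last M) ^ 2) ^ (N+M+1)) *
      volume (AA N M (fun i => (4 * M + 2) * t i.castSucc)) := by
  set ρ := t (Fin.last M) with hρ
  have hρ0 : 0 < ρ := ht _
  set S := AA N M (fun i => (4 * M + 2) * t i.castSucc) with hS
  let E : Fin (N+1) × Fin (M+1) → Set (Fin (N+1) → Fin (M+1) → ℂ) := fun x =>
    {H | H x.1 x.2 ∈ Metric.closedBall (0:ℂ) ρ ∧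
      (fun j => H x.1 (x.2.succAbove j)) ∈ Metric.closedBall (0 : Fin M → ℂ) ρ ∧
      (fun i => H (x.1.succAbove i) x.2) ∈ Metric.closedBall (0 : Fin N → ℂ) ρ ∧
      schur x.1 x.2 H ∈ S}
  have hsub : AA (N+1) (M+1) t ⊆ ⋃ x, E x := by
    intro H hH
    obtain ⟨⟨p, q⟩, hpq⟩ := Finite.exists_max (fun x : Fin (N+1) × Fin (M+1) => ‖H x.1 x.2‖)
    have hent : ∀ i j, ‖H i j‖ ≤ ρ := by
      have := hH (Fin.last M)
      simp only [Fin.val_last] at this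
      exact this.entry
    refine mem_iUnion.mpr ⟨(p, q), ?_, ?_, ?_, ?_⟩
    · simpa using hent p q
    · simp only [Metric.mem_closedBall, dist_zero_right]
      rw [pi_norm_le_iff_of_nonneg hρ0.le]
      exact fun j => hent _ _
    · simp only [Metric.mem_closedBall, dist_zero_right]
      rw [pi_norm_le_iff_of_nonneg hρ0.le]
      exact fun j => hent _ _
    · intro i
      exact SSmall.schur p q H (fun i j => hpq (i, j)) (by omega) (ht _) (hH i.castSucc)
  refine (measure_mono hsub).trans ((measure_iUnion_fintype_le _ _).trans_eq ?_)
  have hE : ∀ x, volume (E x) = ENNReal.ofReal ((Real.pi * ρ ^ 2) ^ (N+M+1)) * volume S := by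
    intro x
    rw [vol_pivot, vol_ball _ hρ0.le, vol_ball_pi _ hρ0.le, vol_ball_pi _ hρ0.le,
      ← ENNReal.ofReal_mul (by positivity), ← ENNReal.ofReal_mul (by positivity)]
    congr 2
    ring
  simp only [hE, Finset.sum_const, Finset.card_univ, Fintype.card_prod, Fintype.card_fin,
    nsmul_eq_mul]
  rw [← mul_assoc, ENNReal.ofReal_mul (by positivity)]
  congr 2
  rw [show ((N:ℝ)+1) * (M+1) = (((N+1) * (M+1) : ℕ) : ℝ) by push_cast; ring,
    ENNReal.ofReal_natCast]

lemma lower_step (N M : ℕ) (t : Fin (M+1) → ℝ) (ht : ∀ i, 0 < t i) (hm : Monotone t) :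
    ENNReal.ofReal ((Real.pi * (t (Fin.last M) / (8 * (M+1))) ^ 2) ^ (N+M+1)) *
      volume (AA N M (fun i => 1 / (2 * (M+1)) * t i.castSucc)) ≤
    volume (AA (N+1) (M+1) t) := by
  set ρ := t (Fin.last M) / (8 * (M+1)) with hρ
  have hρ0 : 0 < ρ := div_pos (ht _) (by positivity)
  have hρt : t (Fin.last M) = 8 * (M+1) * ρ := by rw [hρ]; field_simp
  set S := AA N M (fun i => 1 / (2 * (M+1)) * t i.castSucc) with hS
  have hv := vol_pivot (N := N) (M := M) 0 0 (Metric.closedBall ((3 * ρ : ℝ) : ℂ) ρ)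
    (Metric.closedBall 0 ρ) (Metric.closedBall 0 ρ) S
  rw [vol_ball _ hρ0.le, vol_ball_pi _ hρ0.le, vol_ball_pi _ hρ0.le,
      ← ENNReal.ofReal_mul (by positivity), ← ENNReal.ofReal_mul (by positivity)] at hv
  have e : (Real.pi * ρ ^ 2) * (Real.pi * ρ ^ 2) ^ M * (Real.pi * ρ ^ 2) ^ N
    = (Real.pi * ρ ^ 2) ^ (N+M+1) := by ring
  rw [← e, ← hv]
  refine measure_mono ?_
  rintro H ⟨ha, hr, hc, hs⟩
  rw [mem_closedBall_iff_norm] at ha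
  rw [mem_closedBall_zero_iff, pi_norm_le_iff_of_nonneg hρ0.le] at hr hc
  have ha3 : ‖((3 * ρ : ℝ) : ℂ)‖ = 3 * ρ := by
    rw [Complex.norm_real, Real.norm_of_nonneg (by positivity)]
  have ha1 : ‖H 0 0‖ ≤ 4 * ρ := by
    have := norm_sub_norm_le (H 0 0) ((3 * ρ : ℝ) : ℂ)
    linarith
  have ha2 : 2 * ρ ≤ ‖H 0 0‖ := by
    have := norm_sub_norm_le ((3 * ρ : ℝ) : ℂ) (H 0 0)
    rw [norm_sub_rev] at this
    linarith
  have ha0 : H 0 0 ≠ 0 := norm_pos_iff.mp (by linarith)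
  have hM1 : (1:ℝ) / (2 * (M+1)) ≤ 1 := by
    rw [div_le_one (by positivity)]
    have : (0:ℝ) ≤ M := by positivity
    linarith
  intro i
  refine Fin.lastCases ?_ (fun i => ?_) i
  · refine ⟨⊤, by simp, fun v _ => ?_⟩
    have hS' : ∀ i j, ‖schur 0 0 H i j‖ ≤ 4 * ρ := by
      intro k j
      cases M with
      | zero => exact j.elim0
      | succ M =>
        have := hs (Fin.last M)
        simp only [Fin.val_last] at this
        refine (this.entry k j).trans ?_
        have h1 : t (Fin.last M).castSucc ≤ t (Fin.last (M+1)) := hm (Fin.le_last _)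
        rw [hρt] at h1
        calc _ ≤ 1 / (2 * (((M+1 : ℕ) : ℝ) + 1)) * (8 * (((M + 1 : ℕ) : ℝ) + 1) * ρ) := by gcongr
          _ = _ := by field_simp; ring
    have hall : ∀ i j, ‖H i j‖ ≤ 8 * ρ := by
      intro i j
      refine Fin.cases ?_ (fun i => ?_) i
      · refine Fin.cases ?_ (fun j => ?_) j
        · linarith
        · have := hr j
          simp only [Fin.succAbove_zero] at this
          linarith
      · refine Fin.cases ?_ (fun j => ?_) j
        · have := hc i
          simp only [Fin.succAbove_zero] at this
          linarith
        · have h1 := hS' i j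
          have h2 := hr j
          have h3 := hc i
          simp only [schur, Fin.succAbove_zero] at h1 h2 h3
          have h4 : ‖H i.succ 0 * (H 0 0)⁻¹ * H 0 j.succ‖ ≤ ρ := by
            rw [norm_mul, norm_mul, norm_inv, ← div_eq_mul_inv]
            calc _ ≤ 1 * ρ := by
                  gcongr
                  exact div_le_one_of_le₀ (by linarith) (norm_nonneg _)
              _ = ρ := one_mul _
          have := norm_sub_norm_le (H i.succ j.succ) (H i.succ 0 * (H 0 0)⁻¹ * H 0 j.succ)
          linarith
    refine (mv_le H (8 * ρ) (by positivity) hall v).trans ?_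
    rw [hρt]
    push_cast
    apply le_of_eq
    ring
  · have := SSmall.of_schur 0 0 H ha0 (mul_pos (by positivity) (ht _)) (hs i)
    obtain ⟨V, hV, h⟩ := this
    refine ⟨V, hV, fun v hv => (h v hv).trans ?_⟩
    refine mul_le_mul_of_nonneg_right ?_ (norm_nonneg _)
    calc _ ≤ 1 * t i.castSucc := by
          gcongr
          exact (ht _).le
      _ = _ := one_mul _

lemma upper_vol (d M : ℕ) : ∃ C : ℝ, 0 < C ∧ ∀ t : Fin M → ℝ, (∀ i, 0 < t i) →
    volume (AA (d+M) M t) ≤ ENNReal.ofReal (C * ∏ i : Fin M, t i ^ (2 * (d + 2 * (i:ℕ) + 1))) := by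
  induction M with
  | zero =>
    refine ⟨1, one_pos, fun t ht => ?_⟩
    refine (measure_mono (subset_univ _)).trans ?_
    rw [volume_pi]
    simp [Measure.pi_univ, volume_pi]
  | succ M ih =>
    obtain ⟨C, hC, ih⟩ := ih
    refine ⟨(((d+M:ℕ):ℝ)+1) * (M+1) * Real.pi ^ (d+M+M+1) * C *
      ∏ i : Fin M, ((4:ℝ) * M + 2) ^ (2 * (d + 2 * (i:ℕ) + 1)), by positivity, fun t ht => ?_⟩
    refine (upper_step (d+M) M t ht).trans ?_
    refine (mul_le_mul_right (ih _ fun i => mul_pos (by positivity) (ht _)) _).trans ?_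
    have hl := ht (Fin.last M)
    rw [← ENNReal.ofReal_mul (by positivity)]
    apply le_of_eq
    congr 1
    simp only [Fin.prod_univ_castSucc, mul_pow, Finset.prod_mul_distrib, Fin.val_castSucc,
      Fin.val_last]
    rw [show 2 * (d + 2 * M + 1) = 2 * (d + M + M + 1) by ring, pow_mul]
    ring

lemma lower_vol (d M : ℕ) : ∃ C : ℝ, 0 < C ∧ ∀ t : Fin M → ℝ, (∀ i, 0 < t i) → Monotone t →
    ENNReal.ofReal (C * ∏ i : Fin M, t i ^ (2 * (d + 2 * (i:ℕ) + 1))) ≤ volume (AA (d+M) M t) := by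
  induction M with
  | zero =>
    refine ⟨1, one_pos, fun t ht _ => ?_⟩
    have : AA (d+0) 0 t = univ := by
      ext H; simp [AA]
    rw [this, volume_pi]
    simp [Measure.pi_univ, volume_pi]
  | succ M ih =>
    obtain ⟨C, hC, ih⟩ := ih
    refine ⟨(Real.pi * (1 / (8 * (M+1))) ^ 2) ^ (d+M+M+1) * C *
      ∏ i : Fin M, (1 / (2 * ((M:ℝ)+1))) ^ (2 * (d + 2 * (i:ℕ) + 1)), by positivity,
      fun t ht hm => ?_⟩
    refine le_trans ?_ (lower_step (d+M) M t ht hm)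
    refine le_trans ?_ (mul_le_mul_right (ih _ (fun i => mul_pos (by positivity) (ht _)) ?_) _)
    · have hl := ht (Fin.last M)
      rw [← ENNReal.ofReal_mul (by positivity)]
      apply le_of_eq
      congr 1
      simp only [Fin.prod_univ_castSucc, mul_pow, Finset.prod_mul_distrib, Fin.val_castSucc,
        Fin.val_last, div_eq_mul_one_div (t (Fin.last M))]
      rw [show 2 * (d + 2 * M + 1) = 2 * (d + M + M + 1) by ring, pow_mul (t (Fin.last M))]
      ring
    · intro i j hij
      have := hm (Fin.castSucc_le_castSucc_iff.mpr hij)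
      dsimp only
      gcongr

lemma quad_form {N M : ℕ} (H : Matrix (Fin N) (Fin M) ℂ) (hA : (Hᴴ * H).IsHermitian)
    (x : EuclideanSpace ℂ (Fin M)) :
    ∑ i, ‖(H *ᵥ x.ofLp) i‖ ^ 2 =
      ∑ j, hA.eigenvalues j * ‖inner ℂ (hA.eigenvectorBasis j) x‖ ^ 2 := by
  set T := toEuclideanLin (Hᴴ * H) with hT
  have hsym : T.IsSymmetric := isSymmetric_toEuclideanLin_iff.mpr hA
  have h1 : inner ℂ x (T x) = ((∑ i, ‖(H *ᵥ x.ofLp) i‖ ^ 2 : ℝ) : ℂ) := by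
    rw [EuclideanSpace.inner_eq_star_dotProduct]
    have : (T x).ofLp = Hᴴ *ᵥ (H *ᵥ x.ofLp) := by
      rw [hT, mulVec_mulVec]; rfl
    rw [this, dotProduct_comm, dotProduct_mulVec, ← star_mulVec]
    simp only [dotProduct, Pi.star_apply, RCLike.star_def, Complex.conj_mul']
    push_cast
    rfl
  have h2 : inner ℂ x (T x) =
      ((∑ j, hA.eigenvalues j * ‖inner ℂ (hA.eigenvectorBasis j) x‖ ^ 2 : ℝ) : ℂ) := by
    rw [← OrthonormalBasis.sum_inner_mul_inner hA.eigenvectorBasis]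
    push_cast
    refine Finset.sum_congr rfl fun j _ => ?_
    have e1 : T (hA.eigenvectorBasis j) = (hA.eigenvalues j : ℂ) • hA.eigenvectorBasis j := by
      apply WithLp.ofLp_injective 2
      have := hA.mulVec_eigenvectorBasis j
      rw [RCLike.real_smul_eq_coe_smul (K := ℂ)] at this
      exact this
    rw [← hsym, e1, inner_smul_left, ← inner_conj_symm x]
    simp only [Complex.conj_ofReal]
    rw [mul_left_comm, Complex.conj_mul']
  rw [h1] at h2
  exact_mod_cast h2

lemma count_eq {M : ℕ} (f g : Fin M → ℝ)
    (h : ∏ i, (Polynomial.X - Polynomial.C ((f i : ℂ))) =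
      ∏ i, (Polynomial.X - Polynomial.C ((g i : ℂ)))) (P : ℝ → Prop) [DecidablePred P] :
    (Finset.univ.filter fun i => P (f i)).card = (Finset.univ.filter fun i => P (g i)).card := by
  have h1 : ∀ f : Fin M → ℝ, (∏ i, (Polynomial.X - Polynomial.C ((f i : ℂ)))).roots.map Complex.re
      = Finset.univ.val.map f := by
    intro f
    rw [Polynomial.roots_prod _ _ (Finset.prod_ne_zero_iff.mpr
      fun i _ => Polynomial.X_sub_C_ne_zero _)]
    simp only [Polynomial.roots_X_sub_C, Multiset.bind_singleton, Multiset.map_map]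
    rfl
  have h2 : Finset.univ.val.map f = Finset.univ.val.map g := by
    rw [← h1 f, ← h1 g, h]
  have h3 := congrArg (Multiset.countP P) h2
  rw [Multiset.countP_map, Multiset.countP_map] at h3
  exact h3

lemma sum_sq_le {n : ℕ} (v : Fin n → ℂ) : ∑ i, ‖v i‖ ^ 2 ≤ n * ‖v‖ ^ 2 := by
  calc ∑ i, ‖v i‖ ^ 2 ≤ ∑ _i : Fin n, ‖v‖ ^ 2 := by
        refine Finset.sum_le_sum fun i _ => ?_
        gcongr
        exact norm_le_pi_norm v i
    _ = _ := by simp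

lemma le_sum_sq {n : ℕ} (v : Fin n → ℂ) : ‖v‖ ^ 2 ≤ ∑ i, ‖v i‖ ^ 2 := by
  have h0 : 0 ≤ ∑ i, ‖v i‖ ^ 2 := by positivity
  rw [← Real.sqrt_le_sqrt_iff h0, Real.sqrt_sq (norm_nonneg _),
    pi_norm_le_iff_of_nonneg (Real.sqrt_nonneg _)]
  intro i
  apply Real.le_sqrt_of_sq_le
  exact Finset.single_le_sum (f := fun i => ‖v i‖ ^ 2) (fun _ _ => by positivity)
    (Finset.mem_univ i)

/-- span of a set of eigenvectors -/
lemma eig_span {M : ℕ} (u : OrthonormalBasis (Fin M) ℂ (EuclideanSpace ℂ (Fin M)))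
    (J : Finset (Fin M)) : ∃ V : Submodule ℂ (Fin M → ℂ), Module.finrank ℂ V = J.card ∧
      ∀ v ∈ V, ∀ k ∉ J, inner ℂ (u k) (WithLp.toLp 2 v) = 0 := by
  let W := Submodule.span ℂ (Set.range fun j : J => u j)
  let e := WithLp.linearEquiv 2 ℂ (Fin M → ℂ)
  refine ⟨W.map (e : EuclideanSpace ℂ (Fin M) →ₗ[ℂ] (Fin M → ℂ)), ?_, ?_⟩
  · rw [LinearEquiv.finrank_map_eq, finrank_span_eq_card]
    · simp
    · exact u.orthonormal.linearIndependent.comp _ Subtype.val_injective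
  · rintro _ ⟨w, hw, rfl⟩ k hk
    change inner ℂ (u k) w = 0
    induction hw using Submodule.span_induction with
    | mem x hx =>
      obtain ⟨j, rfl⟩ := hx
      refine u.orthonormal.2 ?_
      rintro rfl
      exact hk j.2
    | zero => simp
    | add x y _ _ hx hy => rw [inner_add_right, hx, hy, add_zero]
    | smul a x _ hx => rw [inner_smul_right, hx, mul_zero]

lemma ssmall_of_sv {N M : ℕ} (H : Matrix (Fin N) (Fin M) ℂ) (σ : Fin M → ℝ)
    (hmono : Monotone σ) (hnn : ∀ i, 0 ≤ σ i)
    (hchar : (Hᴴ * H).charpoly = ∏ i, (Polynomial.X - Polynomial.C ((σ i : ℂ) ^ 2)))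
    (i : Fin M) {s : ℝ} (h : σ i ≤ s) :
    SSmall (fun a b => H a b) ((i:ℕ)+1) (M * s) := by
  have hA : (Hᴴ * H).IsHermitian := isHermitian_conjTranspose_mul_self H
  have hs : 0 ≤ s := (hnn i).trans h
  have hc := count_eq hA.eigenvalues (fun i => σ i ^ 2) (by
    have := hA.charpoly_eq
    rw [hchar] at this
    push_cast
    exact this.symm) (fun x => x ≤ s ^ 2)
  set J := Finset.univ.filter fun j => hA.eigenvalues j ≤ s ^ 2 with hJ
  obtain ⟨V, hV, hV2⟩ := eig_span hA.eigenvectorBasis J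
  refine ⟨V, ?_, fun v hv => ?_⟩
  · rw [hV, hc]
    have : Finset.Iic i ⊆ Finset.univ.filter fun j => σ j ^ 2 ≤ s ^ 2 := by
      intro j hj
      simp only [Finset.mem_Iic] at hj
      simp only [Finset.mem_filter, Finset.mem_univ, true_and]
      have := hmono hj
      have := hnn j
      gcongr
      linarith
    have := Finset.card_le_card this
    simpa using this
  · have hq := quad_form H hA (WithLp.toLp 2 v)
    have hn := hA.eigenvectorBasis.sum_sq_norm_inner_right (WithLp.toLp 2 v)
    rw [EuclideanSpace.norm_sq_eq] at hn
    have h1 : ∑ j, hA.eigenvalues j * ‖inner ℂ (hA.eigenvectorBasis j) (WithLp.toLp 2 v)‖ ^ 2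
        ≤ ∑ j, s ^ 2 * ‖inner ℂ (hA.eigenvectorBasis j) (WithLp.toLp 2 v)‖ ^ 2 := by
      refine Finset.sum_le_sum fun j _ => ?_
      by_cases hj : j ∈ J
      · have : hA.eigenvalues j ≤ s ^ 2 := by simpa [hJ] using hj
        gcongr
      · rw [hV2 v hv j hj]; simp
    rw [← hq, ← Finset.mul_sum, hn] at h1
    have h2 := le_sum_sq (mv (fun a b => H a b) v)
    have h3 := sum_sq_le v
    have h4 : ‖mv (fun a b => H a b) v‖ ^ 2 ≤ s ^ 2 * (M * ‖v‖ ^ 2) :=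
      h2.trans (h1.trans (mul_le_mul_of_nonneg_left h3 (by positivity)))
    have hM : (1:ℝ) ≤ M := by
      have := i.pos
      exact_mod_cast this
    refine (pow_le_pow_iff_left₀ (norm_nonneg _) (by positivity) two_ne_zero).mp ?_
    refine h4.trans ?_
    have : 0 ≤ (M:ℝ) * (s ^ 2 * ‖v‖ ^ 2) := by positivity
    nlinarith

lemma sv_of_ssmall {N M : ℕ} (H : Matrix (Fin N) (Fin M) ℂ) (σ : Fin M → ℝ)
    (hmono : Monotone σ) (hnn : ∀ i, 0 ≤ σ i)
    (hchar : (Hᴴ * H).charpoly = ∏ i, (Polynomial.X - Polynomial.C ((σ i : ℂ) ^ 2)))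
    (i : Fin M) {s : ℝ} (hs : 0 ≤ s)
    (h : SSmall (fun a b => H a b) ((i:ℕ)+1) s) : σ i ≤ (N + 1) * s := by
  have hA : (Hᴴ * H).IsHermitian := isHermitian_conjTranspose_mul_self H
  by_contra hlt
  push Not at hlt
  have hc := count_eq hA.eigenvalues (fun i => σ i ^ 2) (by
    have := hA.charpoly_eq
    rw [hchar] at this
    push_cast
    exact this.symm) (fun x => σ i ^ 2 ≤ x)
  set J := Finset.univ.filter fun j => σ i ^ 2 ≤ hA.eigenvalues j with hJ
  obtain ⟨W, hW, hW2⟩ := eig_span hA.eigenvectorBasis J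
  obtain ⟨V, hV, hV2⟩ := h
  have hcard : M - i ≤ J.card := by
    rw [hc]
    have : Finset.Ici i ⊆ Finset.univ.filter fun j => σ i ^ 2 ≤ σ j ^ 2 := by
      intro j hj
      simp only [Finset.mem_Ici] at hj
      simp only [Finset.mem_filter, Finset.mem_univ, true_and]
      have := hmono hj
      have := hnn i
      gcongr
    have := Finset.card_le_card this
    simpa using this
  have hne : V ⊓ W ≠ ⊥ := by
    intro hbot
    have h1 := Submodule.finrank_sup_add_finrank_inf_eq V W
    have h2 := Submodule.finrank_le (V ⊔ W)
    rw [hbot, finrank_bot] at h1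
    simp only [Module.finrank_fintype_fun_eq_card, Fintype.card_fin] at h2
    have := i.2
    omega
  obtain ⟨v, hv, hv0⟩ := Submodule.exists_mem_ne_zero_of_ne_bot hne
  have hq := quad_form H hA (WithLp.toLp 2 v)
  have hn := hA.eigenvectorBasis.sum_sq_norm_inner_right (WithLp.toLp 2 v)
  rw [EuclideanSpace.norm_sq_eq] at hn
  have h1 : ∑ j, σ i ^ 2 * ‖inner ℂ (hA.eigenvectorBasis j) (WithLp.toLp 2 v)‖ ^ 2
      ≤ ∑ j, hA.eigenvalues j * ‖inner ℂ (hA.eigenvectorBasis j) (WithLp.toLp 2 v)‖ ^ 2 := by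
    refine Finset.sum_le_sum fun j _ => ?_
    by_cases hj : j ∈ J
    · have : σ i ^ 2 ≤ hA.eigenvalues j := by simpa [hJ] using hj
      gcongr
    · rw [hW2 v hv.2 j hj]; simp
  rw [← hq, ← Finset.mul_sum, hn] at h1
  have h2 := sum_sq_le (mv (fun a b => H a b) v)
  have h3 := le_sum_sq v
  have hvp : 0 < ‖v‖ := norm_pos_iff.mpr hv0
  have h4 : σ i ^ 2 * ‖v‖ ^ 2 ≤ N * (s * ‖v‖) ^ 2 := by
    refine (mul_le_mul_of_nonneg_left h3 (by positivity)).trans (h1.trans (h2.trans ?_))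
    have := hV2 v hv.1
    gcongr
  have h5 : σ i ^ 2 ≤ N * s ^ 2 := by
    rw [mul_pow, ← mul_assoc] at h4
    exact le_of_mul_le_mul_right h4 (by positivity)
  have h6 : ((N + 1) * s) ^ 2 < σ i ^ 2 := by gcongr
  have : 0 ≤ (N:ℝ) * s ^ 2 := by positivity
  have : 0 ≤ (N:ℝ) ^ 2 * s ^ 2 := by positivity
  nlinarith [sq_nonneg s]

def reIm (N M : ℕ) : (Fin N → Fin M → ℂ) ≃ᵐ ((Fin N × Fin M × Bool) → ℝ) where
  toFun H := fun x => match x with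
    | (i, j, false) => (H i j).re
    | (i, j, true) => (H i j).im
  invFun g := fun i j => matOf g i j
  left_inv H := by
    ext i j
    simp [matOf, Complex.re_add_im]
  right_inv g := by
    ext ⟨i, j, b⟩
    cases b <;> simp [matOf]
  measurable_toFun := by
    refine measurable_pi_lambda _ ?_
    rintro ⟨i, j, b⟩
    cases b
    · change Measurable fun H : Fin N → Fin M → ℂ => (H i j).re
      fun_prop
    · change Measurable fun H : Fin N → Fin M → ℂ => (H i j).im
      fun_prop
  measurable_invFun := by
    refine measurable_pi_lambda _ fun i => measurable_pi_lambda _ fun j => ?_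
    change Measurable fun g : (Fin N × Fin M × Bool) → ℝ =>
      (g (i, j, false) : ℂ) + (g (i, j, true) : ℂ) * Complex.I
    fun_prop

lemma vol_reIm (s t : Set ℝ) : volume {z : ℂ | z.re ∈ s ∧ z.im ∈ t} = volume s * volume t := by
  have h := Complex.volume_preserving_equiv_real_prod.measure_preimage_equiv (s ×ˢ t)
  rw [Measure.volume_eq_prod, Measure.prod_prod] at h
  rw [← h]
  rfl

lemma reIm_mp (N M : ℕ) : MeasurePreserving (reIm N M) volume volume := by
  refine ⟨(reIm N M).measurable, ?_⟩
  rw [volume_pi (α := fun _ : Fin N × Fin M × Bool => ℝ)]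
  refine (Measure.pi_eq fun s _ => ?_).symm
  rw [MeasurableEquiv.map_apply]
  have : (reIm N M) ⁻¹' (univ.pi s) = univ.pi fun i => univ.pi fun j =>
      {z : ℂ | z.re ∈ s (i, j, false) ∧ z.im ∈ s (i, j, true)} := by
    ext H
    simp only [mem_preimage, mem_univ_pi]
    constructor
    · intro h i j
      exact ⟨h (i, j, false), h (i, j, true)⟩
    · rintro h ⟨i, j, b⟩
      cases b
      · exact (h i j).1
      · exact (h i j).2
  rw [this, volume_pi_pi]
  simp_rw [volume_pi_pi, vol_reIm]
  simp [Fintype.prod_prod_type, mul_comm]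

lemma pi_compare {ι : Type*} [Fintype ι] (μ ν : Measure ℝ) [SigmaFinite μ] [SigmaFinite ν]
    (c : ENNReal) (h : ∀ s, c * μ s ≤ ν s) (S : Set (ι → ℝ)) :
    c ^ Fintype.card ι * Measure.pi (fun _ : ι => μ) S ≤ Measure.pi (fun _ : ι => ν) S := by
  have key : (c ^ Fintype.card ι • Measure.pi (fun _ : ι => μ)) ≤ Measure.pi (fun _ : ι => ν) := by
    rw [Measure.le_iff]
    intro s hs
    have h1 : Measure.pi (fun _ : ι => ν) s =
        OuterMeasure.pi (fun _ : ι => ν.toOuterMeasure) s := by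
      rw [Measure.pi]
      exact toMeasure_apply _ _ hs
    rw [h1]
    have h2 : (c ^ Fintype.card ι • Measure.pi (fun _ : ι => μ)).toOuterMeasure ≤
        OuterMeasure.pi (fun _ : ι => ν.toOuterMeasure) := by
      rw [OuterMeasure.le_pi]
      intro s _
      change (c ^ Fintype.card ι • Measure.pi (fun _ : ι => μ)) (univ.pi s) ≤ ∏ i, ν (s i)
      rw [Measure.smul_apply, Measure.pi_pi, smul_eq_mul]
      have : c ^ Fintype.card ι * ∏ i, μ (s i) = ∏ i, (c * μ (s i)) := by
        rw [Finset.prod_mul_distrib]; simp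
      rw [this]
      exact Finset.prod_le_prod' fun i _ => h _
    exact h2 s
  exact key S

lemma gauss_le (s : Set ℝ) : 1 * gaussianReal 0 (1/2) s ≤ volume s := by
  rw [one_mul]
  have hle : gaussianReal 0 (1/2) ≤ volume := by
    rw [gaussianReal_of_var_ne_zero _ (by norm_num)]
    conv_rhs => rw [← withDensity_one (μ := (volume : Measure ℝ))]
    refine withDensity_mono (Eventually.of_forall fun x => ?_)
    simp only [gaussianPDF, gaussianPDFReal, Pi.one_apply]
    rw [ENNReal.ofReal_le_one]
    have h1 : Real.exp (-(x - 0) ^ 2 / (2 * ((1/2 : NNReal) : ℝ))) ≤ 1 := by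
      rw [Real.exp_le_one_iff]
      apply div_nonpos_of_nonpos_of_nonneg
      · nlinarith [sq_nonneg (x - 0)]
      · positivity
    have h2 : (√(2 * Real.pi * ((1/2 : NNReal) : ℝ)))⁻¹ ≤ 1 := by
      apply inv_le_one_of_one_le₀
      rw [Real.one_le_sqrt]
      push_cast
      linarith [Real.pi_gt_three]
    calc _ ≤ (1:ℝ) * 1 := mul_le_mul h2 h1 (Real.exp_pos _).le zero_le_one
      _ = 1 := one_mul _
  exact hle s

lemma le_gauss : ∃ c : ℝ, 0 < c ∧ ∀ s : Set ℝ,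
    ENNReal.ofReal c * (volume.restrict (Icc (-1) 1)) s ≤ gaussianReal 0 (1/2) s := by
  refine ⟨(√(2 * Real.pi * ((1/2 : NNReal) : ℝ)))⁻¹ * Real.exp (-1), ?_, fun s => ?_⟩
  · have : (0:ℝ) < √(2 * Real.pi * ((1/2 : NNReal) : ℝ)) := by
      apply Real.sqrt_pos.mpr
      push_cast
      linarith [Real.pi_gt_three]
    positivity
  set c := (√(2 * Real.pi * ((1/2 : NNReal) : ℝ)))⁻¹ * Real.exp (-1) with hc
  have hle : ENNReal.ofReal c • (volume.restrict (Icc (-1) 1)) ≤ gaussianReal 0 (1/2) := by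
    rw [gaussianReal_of_var_ne_zero _ (by norm_num), ← withDensity_const,
      ← withDensity_indicator measurableSet_Icc]
    refine withDensity_mono (Eventually.of_forall fun x => ?_)
    by_cases hx : x ∈ Icc (-1:ℝ) 1
    · rw [indicator_of_mem hx]
      simp only [gaussianPDF, gaussianPDFReal]
      apply ENNReal.ofReal_le_ofReal
      rw [hc]
      gcongr
      push_cast
      have := hx.1
      have := hx.2
      norm_num
      exact abs_le.mpr hx
    · rw [indicator_of_notMem hx]
      exact zero_le
  exact hle s

lemma gauss_upper (N M : ℕ) (S : Set ((Fin N × Fin M × Bool) → ℝ)) :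
    gaussMatMeasure N M S ≤ volume S := by
  have := pi_compare (ι := Fin N × Fin M × Bool) _ _ 1 gauss_le S
  simpa [gaussMatMeasure, volume_pi] using this

lemma gauss_lower (N M : ℕ) : ∃ c : ℝ, 0 < c ∧ ∀ S : Set ((Fin N × Fin M × Bool) → ℝ),
    (∀ g ∈ S, ∀ x, g x ∈ Icc (-1:ℝ) 1) →
    ENNReal.ofReal c * volume S ≤ gaussMatMeasure N M S := by
  obtain ⟨c, hc, h⟩ := le_gauss
  refine ⟨c ^ Fintype.card (Fin N × Fin M × Bool), by positivity, fun S hS => ?_⟩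
  have := pi_compare (ι := Fin N × Fin M × Bool) _ _ _ h S
  rw [← Measure.restrict_pi_pi, Measure.restrict_apply' (MeasurableSet.univ_pi
    fun _ => measurableSet_Icc)] at this
  have hsub : S ⊆ univ.pi fun _ => Icc (-1:ℝ) 1 := fun g hg x _ => hS g hg x
  rw [inter_eq_left.mpr hsub] at this
  rw [ENNReal.ofReal_pow hc.le]
  exact this

lemma prod_rpow {M : ℕ} (κ ε : ℝ) (hε : 0 < ε) (b : Fin M → ℝ) (k : Fin M → ℕ) :
    ∏ i, (κ * ε ^ b i) ^ k i = (∏ i, κ ^ k i) * ε ^ (∑ i, (k i : ℝ) * b i) := by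
  simp only [mul_pow, Finset.prod_mul_distrib]
  rw [Real.rpow_sum_of_pos hε]
  congr 1
  refine Finset.prod_congr rfl fun i _ => ?_
  rw [← Real.rpow_mul_natCast hε.le, mul_comm]

lemma log_limit (p : ℝ → ℝ) (K c C : ℝ) (hc : 0 < c) (hC : 0 < C)
    (h1 : ∀ ε, 0 < ε → ε < 1 → c * ε ^ K ≤ p ε) (h2 : ∀ ε, 0 < ε → ε < 1 → p ε ≤ C * ε ^ K) :
    Tendsto (fun ε => Real.log (p ε) / Real.log ε) (nhdsWithin 0 (Ioi 0)) (nhds K) := by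
  have hlim : ∀ a : ℝ, Tendsto (fun ε => K + Real.log a / Real.log ε)
      (nhdsWithin 0 (Ioi 0)) (nhds K) := by
    intro a
    have := (tendsto_const_nhds (x := K) (f := nhdsWithin (0:ℝ) (Ioi 0))).add
      (tendsto_const_nhds (x := Real.log a).div_atBot Real.tendsto_log_nhdsGT_zero)
    simpa using this
  have hev : ∀ᶠ ε : ℝ in nhdsWithin 0 (Ioi 0), 0 < ε ∧ ε < 1 :=
    Ioo_mem_nhdsGT zero_lt_one
  have hlog : ∀ a ε : ℝ, 0 < a → 0 < ε → Real.log (a * ε ^ K) = Real.log a + K * Real.log ε := by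
    intro a ε ha hε
    rw [Real.log_mul ha.ne' (Real.rpow_pos_of_pos hε _).ne', Real.log_rpow hε]
  refine tendsto_of_tendsto_of_tendsto_of_le_of_le' (hlim C) (hlim c) ?_ ?_
  · filter_upwards [hev] with ε ⟨h0, hl⟩
    have hn := Real.log_neg h0 hl
    have hp : 0 < p ε := lt_of_lt_of_le (by positivity) (h1 ε h0 hl)
    have := Real.log_le_log hp (h2 ε h0 hl)
    rw [hlog _ _ hC h0] at this
    rw [le_div_iff_of_neg hn, add_mul, div_mul_cancel₀ _ hn.ne]
    linarith
  · filter_upwards [hev] with ε ⟨h0, hl⟩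
    have hn := Real.log_neg h0 hl
    have := Real.log_le_log (by positivity) (h1 ε h0 hl)
    rw [hlog _ _ hc h0] at this
    rw [div_le_iff_of_neg hn, add_mul, div_mul_cancel₀ _ hn.ne]
    linarith

/-- Let `H` be an `N × M` random matrix (`M ≤ N`) with i.i.d.
circularly-symmetric complex Gaussian entries of zero mean and unit variance, with ordered
singular values `σ₁ ≤ … ≤ σ_M` (encoded by `σs`: monotone, nonnegative, and with squares
the roots of the characteristic polynomial of `HᴴH`).  For exponents
`b₁ ≥ b₂ ≥ … ≥ b_M > 0`,
`lim_{ε→0⁺} log Pr{σ₁ ≤ ε^{b₁}, …, σ_M ≤ ε^{b_M}} / log ε = Σᵢ 2(N−M+2i−1)bᵢ`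
(with `i` running from `1` to `M`; below `i : Fin M` is zero-based, whence `N−M+2i+1`). -/
theorem singular_values_joint_small_deviation_exponent
    (M N : ℕ) (hM : 1 ≤ M) (hMN : M ≤ N)
    (σs : ((Fin N × Fin M × Bool) → ℝ) → Fin M → ℝ)
    (hmono : ∀ g, Monotone (σs g))
    (hnonneg : ∀ g i, 0 ≤ σs g i)
    (hchar : ∀ g, ((matOf g).conjTranspose * matOf g).charpoly =
        ∏ i, (Polynomial.X - Polynomial.C ((σs g i : ℂ) ^ 2)))
    (b : Fin M → ℝ) (hb : Antitone b) (hbpos : ∀ i, 0 < b i) :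
    Filter.Tendsto (fun ε : ℝ =>
        Real.log (((gaussMatMeasure N M)
            {g | ∀ i, σs g i ≤ ε ^ b i}).toReal) / Real.log ε)
      (nhdsWithin 0 (Set.Ioi 0))
      (nhds (∑ i : Fin M, 2 * ((N : ℝ) - (M : ℝ) + 2 * ((i : ℕ) : ℝ) + 1) * b i)) := by
  obtain ⟨d, rfl⟩ := Nat.exists_eq_add_of_le' hMN
  obtain ⟨C, hC, hup⟩ := upper_vol d M
  obtain ⟨c, hc, hlow⟩ := lower_vol d M
  obtain ⟨g0, hg0, hgl⟩ := gauss_lower (d + M) M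
  have hM0 : (0:ℝ) < M := by exact_mod_cast hM
  have hvol : ∀ A : Set (Fin (d+M) → Fin M → ℂ), volume ((reIm (d+M) M).symm ⁻¹' A) = volume A :=
    fun A => ((reIm_mp (d+M) M).symm _).measure_preimage_equiv A
  have hK : ∑ i : Fin M, 2 * (((d + M : ℕ) : ℝ) - (M : ℝ) + 2 * ((i : ℕ) : ℝ) + 1) * b i =
      ∑ i : Fin M, ((2 * (d + 2 * (i:ℕ) + 1) : ℕ) : ℝ) * b i := by
    refine Finset.sum_congr rfl fun i _ => ?_
    push_cast
    ring
  rw [hK]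
  set k : Fin M → ℕ := fun i => 2 * (d + 2 * (i:ℕ) + 1) with hk
  have hN0 : (0:ℝ) < ((d + M : ℕ) : ℝ) + 1 := by positivity
  refine log_limit _ _ (g0 * (c * ∏ i, (1 / (((d + M : ℕ) : ℝ) + 1)) ^ k i))
    (C * ∏ i, (M:ℝ) ^ k i) (by positivity) (by positivity) ?_ ?_
  · intro ε h0 h1
    have hfin : gaussMatMeasure (d+M) M {g | ∀ i, σs g i ≤ ε ^ b i} ≠ ⊤ := by
      have : IsProbabilityMeasure (gaussMatMeasure (d+M) M) := by
        unfold gaussMatMeasure; infer_instance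
      exact measure_ne_top _ _
    rw [← ENNReal.ofReal_le_iff_le_toReal hfin]
    set t : Fin M → ℝ := fun i => 1 / (((d + M : ℕ) : ℝ) + 1) * ε ^ b i with ht
    have htpos : ∀ i, 0 < t i := fun i => by
      have := Real.rpow_pos_of_pos h0 (b i)
      positivity
    have htmono : Monotone t := fun i j hij => by
      have := Real.rpow_le_rpow_of_exponent_ge h0 h1.le (hb hij)
      simp only [ht]
      gcongr
    have htle : ∀ i, t i ≤ 1 := fun i => by
      have e1 := Real.rpow_le_one h0.le h1.le (hbpos i).le
      have e2 : 1 / (((d + M : ℕ) : ℝ) + 1) ≤ 1 := by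
        rw [div_le_one hN0]
        have : (0:ℝ) ≤ ((d + M : ℕ) : ℝ) := by positivity
        linarith
      exact mul_le_one₀ e2 (Real.rpow_pos_of_pos h0 _).le e1
    have hsub : (reIm (d+M) M).symm ⁻¹' (AA (d+M) M t) ⊆ {g | ∀ i, σs g i ≤ ε ^ b i} := by
      intro g hg i
      have e1 := sv_of_ssmall (matOf g) (σs g) (hmono g) (hnonneg g) (hchar g) i (htpos i).le (hg i)
      refine e1.trans_eq ?_
      simp only [ht]
      field_simp
    have hbox : ∀ g ∈ (reIm (d+M) M).symm ⁻¹' (AA (d+M) M t), ∀ x, g x ∈ Icc (-1:ℝ) 1 := by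
      rintro g hg ⟨i, j, s⟩
      have e0 : SSmall (fun a b => matOf g a b) M (t ⟨M - 1, by omega⟩) := by
        have := hg ⟨M - 1, by omega⟩
        simp only [Nat.sub_add_cancel hM] at this
        exact this
      have e1 : ‖matOf g i j‖ ≤ 1 := (e0.entry i j).trans (htle _)
      rw [mem_Icc, ← abs_le]
      cases s
      · have := (Complex.abs_re_le_norm (matOf g i j)).trans e1
        simpa [matOf] using this
      · have := (Complex.abs_im_le_norm (matOf g i j)).trans e1
        simpa [matOf] using this
    have e1 := hgl _ hbox
    rw [hvol] at e1
    refine le_trans ?_ (e1.trans (measure_mono hsub))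
    rw [mul_assoc, ENNReal.ofReal_mul hg0.le]
    refine le_trans (mul_le_mul_right ?_ _) (mul_le_mul_right (hlow t htpos htmono) _)
    apply ENNReal.ofReal_le_ofReal
    have e2 := prod_rpow (1 / (((d + M : ℕ) : ℝ) + 1)) ε h0 b k
    rw [mul_assoc, ← e2]
  · intro ε h0 h1
    have hsub : {g | ∀ i, σs g i ≤ ε ^ b i} ⊆
        (reIm (d+M) M).symm ⁻¹' (AA (d+M) M fun i => (M:ℝ) * ε ^ b i) := by
      intro g hg i
      exact ssmall_of_sv (matOf g) (σs g) (hmono g) (hnonneg g) (hchar g) i (hg i)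
    apply ENNReal.toReal_le_of_le_ofReal (by positivity)
    refine (gauss_upper _ _ _).trans ((measure_mono hsub).trans ?_)
    rw [hvol]
    refine (hup _ fun i => mul_pos hM0 (Real.rpow_pos_of_pos h0 _)).trans ?_
    apply ENNReal.ofReal_le_ofReal
    have e2 := prod_rpow (M:ℝ) ε h0 b k
    rw [mul_assoc, ← e2]
end
end

section
/- Let M ≥ 2. For every integer k ≥ 0, the number of integer vectors z ∈ ℤ^{2M} such that the greatest common divisor of the entries of z equals 1 and 2^{k−1} < ‖z‖_∞ ≤ 2^k is at least 2^{2Mk}. -/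
open Finset

lemma aux_sum (K : ℕ) :
    ∑ d ∈ Finset.range K, (1 : ℚ) / ((d : ℚ) + 2) ^ 2 ≤ 2 / 3 - 1 / ((K : ℚ) + 3 / 2) := by
  induction K with
  | zero => norm_num
  | succ K ih =>
    rw [Finset.sum_range_succ]
    have hK : (0 : ℚ) ≤ K := Nat.cast_nonneg K
    have : (1 : ℚ) / ((K : ℚ) + 2) ^ 2 ≤ 1 / ((K : ℚ) + 3 / 2) - 1 / ((K : ℚ) + 1 + 3 / 2) := by
      rw [div_sub_div _ _ (by positivity) (by positivity), div_le_div_iff₀ (by positivity) (by positivity)]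
      nlinarith
    push_cast
    linarith

noncomputable def auxP (N : ℕ) : Finset (ℕ × ℕ) :=
  (Finset.Icc 1 N ×ˢ Finset.Icc 1 N).filter fun p => Nat.gcd p.1 p.2 = 1

lemma auxP_card (N : ℕ) : N ^ 2 ≤ 4 * (auxP N).card := by
  have h1 : (auxP N).card + ((Finset.Icc 1 N ×ˢ Finset.Icc 1 N).filter
      fun p : ℕ × ℕ => ¬ Nat.gcd p.1 p.2 = 1).card = N ^ 2 := by
    rw [auxP, Finset.card_filter_add_card_filter_not]
    simp [sq]
  have h2 : ((Finset.Icc 1 N ×ˢ Finset.Icc 1 N).filter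
      fun p : ℕ × ℕ => ¬ Nat.gcd p.1 p.2 = 1) ⊆
      (Finset.range N).biUnion fun d => (Finset.Icc 1 (N / (d + 2)) ×ˢ Finset.Icc 1 (N / (d + 2))).image
        fun p : ℕ × ℕ => ((d + 2) * p.1, (d + 2) * p.2) := by
    rintro ⟨a, b⟩ h
    simp only [Finset.mem_filter, Finset.mem_product, Finset.mem_Icc] at h
    obtain ⟨⟨⟨ha, haN⟩, hb, hbN⟩, hg⟩ := h
    have hpos : 0 < Nat.gcd a b := Nat.gcd_pos_of_pos_left _ ha
    have hle : Nat.gcd a b ≤ a := Nat.gcd_le_left _ ha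
    obtain ⟨d, hd⟩ : ∃ d, Nat.gcd a b = d + 2 := ⟨Nat.gcd a b - 2, by omega⟩
    obtain ⟨x, hx⟩ : (d + 2) ∣ a := hd ▸ Nat.gcd_dvd_left a b
    obtain ⟨y, hy⟩ : (d + 2) ∣ b := hd ▸ Nat.gcd_dvd_right a b
    simp only [Finset.mem_biUnion, Finset.mem_range, Finset.mem_image, Finset.mem_product,
      Finset.mem_Icc, Prod.mk.injEq, Prod.exists]
    refine ⟨d, by omega, x, y, ⟨⟨?_, ?_⟩, ?_, ?_⟩, hx.symm, hy.symm⟩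
    · rcases Nat.eq_zero_or_pos x with h | h
      · subst h; omega
      · exact h
    · rw [Nat.le_div_iff_mul_le (by omega)]; rw [mul_comm]; omega
    · rcases Nat.eq_zero_or_pos y with h | h
      · subst h; omega
      · exact h
    · rw [Nat.le_div_iff_mul_le (by omega)]; rw [mul_comm]; omega
  have h3 := (Finset.card_le_card h2).trans Finset.card_biUnion_le
  have h4 : ∀ d ∈ Finset.range N, ((Finset.Icc 1 (N / (d + 2)) ×ˢ Finset.Icc 1 (N / (d + 2))).image
        fun p : ℕ × ℕ => ((d + 2) * p.1, (d + 2) * p.2)).card ≤ (N / (d + 2)) ^ 2 := by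
    intro d _
    refine Finset.card_image_le.trans ?_
    simp [sq]
  have h5 := h3.trans (Finset.sum_le_sum h4)
  have h6 : ((∑ d ∈ Finset.range N, (N / (d + 2)) ^ 2 : ℕ) : ℚ) ≤ (N : ℚ) ^ 2 * (2 / 3) := by
    push_cast
    calc ∑ d ∈ Finset.range N, (((N / (d + 2) : ℕ) : ℚ)) ^ 2
        ≤ ∑ d ∈ Finset.range N, (N : ℚ) ^ 2 * (1 / ((d : ℚ) + 2) ^ 2) := by
          refine Finset.sum_le_sum fun d _ => ?_
          have : ((N / (d + 2) : ℕ) : ℚ) ≤ (N : ℚ) / ((d : ℚ) + 2) := by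
            have := @Nat.cast_div_le ℚ _ _ _ N (d + 2)
            push_cast at this
            exact this
          calc _ ≤ ((N : ℚ) / ((d : ℚ) + 2)) ^ 2 := by gcongr
            _ = _ := by rw [div_pow]; ring
      _ = (N : ℚ) ^ 2 * ∑ d ∈ Finset.range N, (1 / ((d : ℚ) + 2) ^ 2) := by rw [Finset.mul_sum]
      _ ≤ _ := by
        gcongr
        have := aux_sum N
        have h : (0 : ℚ) ≤ 1 / ((N : ℚ) + 3 / 2) := by positivity
        linarith
  have h7 : (∑ d ∈ Finset.range N, (N / (d + 2)) ^ 2) * 3 ≤ N ^ 2 * 2 := by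
    have : ((∑ d ∈ Finset.range N, (N / (d + 2)) ^ 2 : ℕ) : ℚ) * 3 ≤ (N : ℚ) ^ 2 * 2 := by linarith
    exact_mod_cast this
  omega

noncomputable def auxT (N : ℕ) : Finset (ℤ × ℤ) :=
  (Finset.Icc (-(N : ℤ)) N ×ˢ Finset.Icc (-(N : ℤ)) N).filter
    fun p => Nat.gcd p.1.natAbs p.2.natAbs = 1

lemma auxT_card (N : ℕ) : N ^ 2 ≤ (auxT N).card := by
  refine (auxP_card N).trans ?_
  have h : (auxP N ×ˢ (({1, -1} : Finset ℤ) ×ˢ ({1, -1} : Finset ℤ))).card = 4 * (auxP N).card := by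
    rw [Finset.card_product, Finset.card_product]
    have : ({1, -1} : Finset ℤ).card = 2 := by decide
    rw [this]; ring
  rw [← h]
  refine Finset.card_le_card_of_injOn
    (fun q : (ℕ × ℕ) × ℤ × ℤ => (q.2.1 * (q.1.1 : ℤ), q.2.2 * (q.1.2 : ℤ))) ?_ ?_
  · rintro ⟨⟨a, b⟩, s, t⟩ h
    simp only [auxP, Finset.coe_product, Set.mem_prod, Finset.mem_coe, Finset.mem_filter,
      Finset.mem_product, Finset.mem_Icc, Finset.mem_insert, Finset.mem_singleton] at h
    obtain ⟨⟨⟨⟨ha, haN⟩, hb, hbN⟩, hg⟩, hs, ht⟩ := h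
    simp only [auxT, Finset.mem_coe, Finset.mem_filter, Finset.mem_product, Finset.mem_Icc]
    rcases hs with rfl | rfl <;> rcases ht with rfl | rfl <;>
      simp [hg] <;> omega
  · rintro ⟨⟨a, b⟩, s, t⟩ h ⟨⟨a', b'⟩, s', t'⟩ h' he
    simp only [auxP, Finset.coe_product, Set.mem_prod, Finset.mem_coe, Finset.mem_filter,
      Finset.mem_product, Finset.mem_Icc, Finset.mem_insert, Finset.mem_singleton] at h h'
    obtain ⟨⟨⟨⟨ha, haN⟩, hb, hbN⟩, hg⟩, hs, ht⟩ := h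
    obtain ⟨⟨⟨⟨ha', haN'⟩, hb', hbN'⟩, hg'⟩, hs', ht'⟩ := h'
    simp only [Prod.mk.injEq] at he ⊢
    obtain ⟨e1, e2⟩ := he
    have A : a = a' ∧ s = s' := by
      rcases hs with rfl | rfl <;> rcases hs' with rfl | rfl <;> constructor <;> omega
    have B : b = b' ∧ t = t' := by
      rcases ht with rfl | rfl <;> rcases ht' with rfl | rfl <;> constructor <;> omega
    exact ⟨⟨A.1, B.1⟩, A.2, B.2⟩

noncomputable def auxU (N : ℕ) : Finset ℤ :=
  Finset.Icc (-(N : ℤ)) N \ Finset.Icc (-((N / 2 : ℕ) : ℤ)) ((N / 2 : ℕ) : ℤ)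

lemma auxU_card (N : ℕ) : N ≤ (auxU N).card := by
  rw [auxU, Finset.card_sdiff_of_subset (Finset.Icc_subset_Icc (by omega) (by omega))]
  simp only [Int.card_Icc]
  omega

lemma aux_main (m N : ℕ) : N ^ (m + 3) ≤
      Set.ncard {z : Fin (m + 3) → ℤ |
        (Finset.univ.gcd fun i => (z i).natAbs) = 1 ∧
        N < 2 * (Finset.univ.sup fun i => (z i).natAbs) ∧
        (Finset.univ.sup fun i => (z i).natAbs) ≤ N} := by
  set W : Finset (Fin m → ℤ) := Fintype.piFinset fun _ => Finset.Icc (-(N : ℤ)) N with hW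
  have hWc : N ^ m ≤ W.card := by
    rw [hW, Fintype.card_piFinset]
    simp only [Int.card_Icc, Finset.prod_const, Finset.card_univ, Fintype.card_fin]
    exact Nat.pow_le_pow_left (by omega) _
  have hc : N ^ (m + 3) ≤ (auxT N ×ˢ (auxU N ×ˢ W)).card := by
    rw [Finset.card_product, Finset.card_product]
    calc N ^ (m + 3) = N ^ 2 * (N * N ^ m) := by ring
      _ ≤ _ := Nat.mul_le_mul (auxT_card N) (Nat.mul_le_mul (auxU_card N) hWc)
  refine hc.trans ?_
  rw [← Set.ncard_coe_finset]
  refine Set.ncard_le_ncard_of_injOn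
    (fun q : (ℤ × ℤ) × ℤ × (Fin m → ℤ) =>
      (Fin.cons q.1.1 (Fin.cons q.1.2 (Fin.cons q.2.1 q.2.2 : Fin (m + 1) → ℤ) : Fin (m + 2) → ℤ) : Fin (m + 3) → ℤ))
      ?_ ?_ ?_
  · rintro ⟨⟨a, b⟩, c, f⟩ h
    simp only [Finset.coe_product, Set.mem_prod, Finset.mem_coe, auxT, auxU, hW, Finset.mem_filter,
      Finset.mem_product, Finset.mem_sdiff, Finset.mem_Icc, Fintype.mem_piFinset] at h
    obtain ⟨⟨⟨ha, hb⟩, hg⟩, ⟨hc1, hc2⟩, hf⟩ := h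
    simp only [Set.mem_ofPred_eq]
    refine ⟨?_, ?_, ?_⟩
    · refine Nat.dvd_one.mp (dvd_trans (Nat.dvd_gcd ?_ ?_) (dvd_of_eq hg))
      · exact Finset.gcd_dvd (Finset.mem_univ (0 : Fin (m + 3)))
      · exact Finset.gcd_dvd (Finset.mem_univ (1 : Fin (m + 3)))
    · have : c.natAbs ≤ _ := Finset.le_sup (f := fun i => ((Fin.cons a (Fin.cons b (Fin.cons c f : Fin (m + 1) → ℤ) : Fin (m + 2) → ℤ) : Fin (m + 3) → ℤ) i).natAbs)
        (Finset.mem_univ (Fin.succ (Fin.succ 0) : Fin (m + 3)))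
      refine lt_of_lt_of_le ?_ (Nat.mul_le_mul_left 2 this)
      omega
    · refine Finset.sup_le fun i _ => ?_
      refine Fin.cases ?_ (fun i => Fin.cases ?_ (fun i => Fin.cases ?_ (fun i => ?_) i) i) i
      · simp only [Fin.cons_zero]; omega
      · simp only [Fin.cons_zero, Fin.cons_succ]; omega
      · simp only [Fin.cons_zero, Fin.cons_succ]; omega
      · have := hf i
        simp only [Fin.cons_succ]; omega
  · rintro ⟨⟨a, b⟩, c, f⟩ _ ⟨⟨a', b'⟩, c', f'⟩ _ he
    simp only [Fin.cons_inj] at he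
    obtain ⟨rfl, rfl, rfl, rfl⟩ := he
    rfl
  · refine Set.Finite.subset
      (Finset.finite_toSet (Fintype.piFinset fun _ : Fin (m + 3) => Finset.Icc (-(N : ℤ)) N)) ?_
    rintro z ⟨_, _, hz⟩
    simp only [Finset.mem_coe, Fintype.mem_piFinset, Finset.mem_Icc]
    intro i
    have := (Finset.le_sup (f := fun i => (z i).natAbs) (Finset.mem_univ i)).trans hz
    omega


/-- For `M ≥ 2` and every integer `k ≥ 0`, the number of integer vectors
`z ∈ ℤ^{2M}` whose entries have greatest common divisor `1` and whose sup-norm `‖z‖_∞`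
satisfies `2^(k-1) < ‖z‖_∞ ≤ 2^k` is at least `2^(2Mk)`. -/
theorem primitive_integer_vectors_in_dyadic_shell (M : ℕ) (hM : 2 ≤ M) (k : ℕ) :
    2 ^ (2 * M * k) ≤
      Set.ncard {z : Fin (2 * M) → ℤ |
        (Finset.univ.gcd fun i => (z i).natAbs) = 1 ∧
        (2 : ℝ) ^ ((k : ℤ) - 1) < ((Finset.univ.sup fun i => (z i).natAbs : ℕ) : ℝ) ∧
        ((Finset.univ.sup fun i => (z i).natAbs : ℕ) : ℝ) ≤ (2 : ℝ) ^ (k : ℤ)} := by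
  obtain ⟨m, hm⟩ : ∃ m, 2 * M = m + 3 := ⟨2 * M - 3, by omega⟩
  rw [mul_comm (2 * M) k, pow_mul]
  generalize 2 * M = n at hm
  subst hm
  refine (aux_main m (2 ^ k)).trans (le_of_eq ?_)
  congr 1
  ext z
  simp only [Set.mem_ofPred_eq]
  generalize (Finset.univ.sup fun i => (z i).natAbs) = s
  refine and_congr_right fun _ => and_congr ?_ ?_
  · rw [zpow_sub_one₀ (by norm_num), zpow_natCast, ← div_eq_mul_inv, div_lt_iff₀ (by norm_num),
      mul_comm 2 s]
    exact_mod_cast Iff.rfl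
  · rw [zpow_natCast]
    exact_mod_cast Iff.rfl
end

section
/- Let z′, z″ ∈ ℤ[i]^M be nonzero Gaussian-integer vectors such that z′ is not a complex scalar multiple of z″. Write z′ = a z″ + r where a = ⟨z′, z″⟩/‖z″‖² ∈ ℂ and r is the component of z′ orthogonal to z″. Then ‖r‖ ≥ 1/‖z″‖. In particular, if the real and imaginary parts of the entries of z″ are bounded in absolute value by ε^{−1/(2M)} for some ε > 0, then ‖r‖ ≥ ε^{1/(2M)}/√(2M). -/
open Matrix Set

noncomputable section

/-- The standard Hermitian inner product on `ℂ^M` (conjugate-linear in the second slot). -/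
def cip {ι : Type*} [Fintype ι] (v w : ι → ℂ) : ℂ := ∑ i, v i * star (w i)

lemma aux_normsq (x : ℂ) : ((‖x‖ ^ 2 : ℝ) : ℂ) = x * star x := by
  have := Complex.mul_conj' x
  push_cast
  exact this.symm

lemma aux_cnorm_sq {ι : Type*} [Fintype ι] (v : ι → ℂ) : cnorm v ^ 2 = ∑ i, ‖v i‖ ^ 2 :=
  Real.sq_sqrt (Finset.sum_nonneg fun _ _ => sq_nonneg _)

lemma aux_cnorm_cip {ι : Type*} [Fintype ι] (v : ι → ℂ) : ((cnorm v : ℂ)) ^ 2 = cip v v := by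
  rw [← Complex.ofReal_pow, aux_cnorm_sq, cip, Complex.ofReal_sum]
  exact Finset.sum_congr rfl fun i _ => aux_normsq _

lemma aux_star_cip {ι : Type*} [Fintype ι] (v w : ι → ℂ) : star (cip v w) = cip w v := by
  simp only [cip, star_sum, star_mul', star_star]
  exact Finset.sum_congr rfl fun i _ => mul_comm _ _

lemma aux_pyth {ι : Type*} [Fintype ι] (v w : ι → ℂ) (hw : cnorm w ≠ 0) :
    cnorm w ^ 2 * (cnorm fun i => v i - (cip v w / (cnorm w : ℂ) ^ 2) * w i) ^ 2
      = cnorm v ^ 2 * cnorm w ^ 2 - ‖cip v w‖ ^ 2 := by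
  have hw' : (cnorm w : ℂ) ≠ 0 := by exact_mod_cast hw
  have hS : cip w w ≠ 0 := by rw [← aux_cnorm_cip]; exact pow_ne_zero _ hw'
  have key : ∀ a : ℂ, cip (fun i => v i - a * w i) (fun i => v i - a * w i)
      = cip v v - star a * cip v w - a * cip w v + a * star a * cip w w := by
    intro a
    simp only [cip, Finset.mul_sum, ← Finset.sum_sub_distrib, ← Finset.sum_add_distrib]
    refine Finset.sum_congr rfl fun i _ => ?_
    simp only [star_sub, star_mul']
    ring
  apply Complex.ofReal_injective
  rw [Complex.ofReal_sub, aux_normsq]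
  push_cast
  simp only [aux_cnorm_cip]
  rw [key, star_div₀, aux_star_cip, aux_star_cip]
  field_simp
  ring

lemma aux_int {M : ℕ} (z w : Fin M → GaussianInt) : ∃ n : ℤ,
    cnorm (fun i => (z i : ℂ)) ^ 2 * cnorm (fun i => (w i : ℂ)) ^ 2
      - ‖cip (fun i => (z i : ℂ)) (fun i => (w i : ℂ))‖ ^ 2 = n := by
  have h1 : ∀ x : GaussianInt, ‖(x : ℂ)‖ ^ 2 = ((x.norm : ℤ) : ℝ) := by
    intro x
    rw [GaussianInt.intCast_real_norm, Complex.normSq_eq_norm_sq]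
  have h2 : cip (fun i => (z i : ℂ)) (fun i => (w i : ℂ))
      = ((∑ i, z i * star (w i) : GaussianInt) : ℂ) := by
    simp only [cip, map_sum, map_mul]
    refine Finset.sum_congr rfl fun i _ => ?_
    rw [GaussianInt.toComplex_star]; rfl
  refine ⟨(∑ i, (z i).norm) * (∑ i, (w i).norm) - (∑ i, z i * star (w i)).norm, ?_⟩
  rw [h2, h1, aux_cnorm_sq, aux_cnorm_sq]
  simp only [h1]
  push_cast
  rfl

lemma aux_pos {ι : Type*} [Fintype ι] (v : ι → ℂ) (h : ∃ i, v i ≠ 0) : 0 < cnorm v := by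
  obtain ⟨i, hi⟩ := h
  apply Real.sqrt_pos.2
  exact Finset.sum_pos' (fun _ _ => sq_nonneg _) ⟨i, Finset.mem_univ _, by positivity⟩

/-- Let `z′, z″ ∈ ℤ[i]^M` be nonzero Gaussian-integer vectors such that
`z′` is not a complex scalar multiple of `z″`.  Write `z′ = a z″ + r` with
`a = ⟨z′,z″⟩/‖z″‖²` and `r ⟂ z″`.  Then `‖r‖ ≥ 1/‖z″‖`; and if moreover the real and
imaginary parts of the entries of `z″` are bounded in absolute value by `ε^(-1/(2M))`
for some `ε > 0`, then `‖r‖ ≥ ε^(1/(2M))/√(2M)`. -/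
theorem orthogonal_component_lower_bound (M : ℕ) (z' z'' : Fin M → GaussianInt)
    (hz' : z' ≠ 0) (hz'' : z'' ≠ 0)
    (hprop : ¬ ∃ c : ℂ, (fun i => (z' i : ℂ)) = fun i => c * (z'' i : ℂ)) :
    (1 / cnorm (fun i => (z'' i : ℂ)) ≤
        cnorm fun i => (z' i : ℂ) -
          (cip (fun j => (z' j : ℂ)) (fun j => (z'' j : ℂ)) /
            (cnorm fun j => (z'' j : ℂ)) ^ 2) * (z'' i : ℂ)) ∧
      ∀ ε : ℝ, 0 < ε →
        (∀ i, |((z'' i).re : ℝ)| ≤ ε ^ (-(1 : ℝ) / (2 * M)) ∧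
              |((z'' i).im : ℝ)| ≤ ε ^ (-(1 : ℝ) / (2 * M))) →
        ε ^ ((1 : ℝ) / (2 * M)) / Real.sqrt (2 * M) ≤
          cnorm fun i => (z' i : ℂ) -
            (cip (fun j => (z' j : ℂ)) (fun j => (z'' j : ℂ)) /
              (cnorm fun j => (z'' j : ℂ)) ^ 2) * (z'' i : ℂ) := by
  have hex : ∃ i, z'' i ≠ 0 := Function.ne_iff.1 hz''
  have hw : 0 < cnorm (fun i => (z'' i : ℂ)) := by
    obtain ⟨i, hi⟩ := hex
    exact aux_pos _ ⟨i, by simpa using hi⟩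
  have hpy := aux_pyth (fun i => (z' i : ℂ)) (fun i => (z'' i : ℂ)) hw.ne'
  obtain ⟨n, hn⟩ := aux_int z' z''
  rw [hn] at hpy
  have hr : 0 < cnorm fun i => (z' i : ℂ) -
          (cip (fun j => (z' j : ℂ)) (fun j => (z'' j : ℂ)) /
            (cnorm fun j => (z'' j : ℂ)) ^ 2) * (z'' i : ℂ) := by
    apply aux_pos
    by_contra! hc
    exact hprop ⟨_, funext fun i => sub_eq_zero.1 (hc i)⟩
  beta_reduce at hpy
  generalize (cnorm fun i => (z' i : ℂ) -
          (cip (fun j => (z' j : ℂ)) (fun j => (z'' j : ℂ)) /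
            (cnorm fun j => (z'' j : ℂ)) ^ 2) * (z'' i : ℂ)) = R at hpy hr ⊢
  have hn1 : (1 : ℝ) ≤ n := by
    have : (0 : ℝ) < n := by rw [← hpy]; positivity
    exact_mod_cast this
  have hmain : 1 / cnorm (fun i => (z'' i : ℂ)) ≤ R := by
    rw [div_le_iff₀ hw]
    by_contra! hlt
    have h0 := mul_pos hr hw
    nlinarith
  refine ⟨hmain, fun ε hε hb => le_trans ?_ hmain⟩
  have hM : 0 < M := by
    obtain ⟨i, _⟩ := hex
    exact i.pos
  have hM' : (0 : ℝ) < M := by exact_mod_cast hM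
  have ht : 0 < ε ^ ((1 : ℝ) / (2 * M)) := Real.rpow_pos_of_pos hε _
  have hinv : ε ^ (-(1 : ℝ) / (2 * M)) = (ε ^ ((1 : ℝ) / (2 * M)))⁻¹ := by
    rw [neg_div, Real.rpow_neg hε.le]
  rw [hinv] at hb
  generalize ε ^ ((1 : ℝ) / (2 * M)) = t at ht hb ⊢
  have hs : 0 < Real.sqrt (2 * M) := Real.sqrt_pos.2 (by positivity)
  have hbound : cnorm (fun i => (z'' i : ℂ)) ≤ Real.sqrt (2 * M) / t := by
    rw [cnorm]
    apply Real.sqrt_le_iff.2 ⟨by positivity, ?_⟩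
    rw [div_pow, Real.sq_sqrt (by positivity)]
    calc ∑ i, ‖(z'' i : ℂ)‖ ^ 2 ≤ ∑ i : Fin M, 2 * (t⁻¹) ^ 2 := by
          refine Finset.sum_le_sum fun i _ => ?_
          rw [← Complex.normSq_eq_norm_sq, Complex.normSq_apply,
            ← GaussianInt.intCast_re, ← GaussianInt.intCast_im]
          have h1 := sq_le_sq' (abs_le.1 (hb i).1).1 (abs_le.1 (hb i).1).2
          have h2 := sq_le_sq' (abs_le.1 (hb i).2).1 (abs_le.1 (hb i).2).2
          nlinarith
      _ = 2 * M / t ^ 2 := by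
          simp
          field_simp
  calc t / Real.sqrt (2 * M) = 1 / (Real.sqrt (2 * M) / t) := by rw [one_div_div]
    _ ≤ _ := one_div_le_one_div_of_le hw hbound
end
end

section
/- Let M ≥ 2, 0 < ε < 1, and let v₁, …, v_M be i.i.d. standard circularly-symmetric complex Gaussian random vectors in ℂ^M; for b ∈ ℂ^M write v_b = b₁v₁ + … + b_M v_M. Let z′, z″ ∈ ℤ[i]^M be nonzero Gaussian-integer vectors such that z′ is not a complex scalar multiple of z″, and such that the real and imaginary parts of all entries of z′ and z″ are bounded in absolute value by ε^{−1/(2M)}. Then Pr{‖v_{z′}‖ ≤ ε and ‖v_{z″}‖ ≤ ε} ≤ ((2M)^M/(M!)²) · ε^{4M−1}. -/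
open MeasureTheory ProbabilityTheory Matrix Filter Set

noncomputable section

/-- Sample space measure for `M` i.i.d. standard circularly-symmetric complex Gaussian
vectors in `ℂ^M`: all `2M²` real coordinates are independent real Gaussians of mean `0`
and variance `1/2`.  The first `Fin M` component indexes the vector, the second the
coordinate, and the `Bool` selects real/imaginary part. -/
def gaussVecMeasure (M : ℕ) : Measure ((Fin M × Fin M × Bool) → ℝ) :=
  Measure.pi fun _ => gaussianReal 0 (1/2)

/-- The `j`-th sample vector `v_j ∈ ℂ^M`. -/
def vecOf {M : ℕ} (g : (Fin M × Fin M × Bool) → ℝ) (j : Fin M) : Fin M → ℂ :=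
  fun i => (g (j, i, false) : ℂ) + (g (j, i, true) : ℂ) * Complex.I

/-- The linear combination `v_b = b₁ v₁ + ⋯ + b_M v_M`. -/
def vb {M : ℕ} (g : (Fin M × Fin M × Bool) → ℝ) (b : Fin M → ℂ) : Fin M → ℂ :=
  fun i => ∑ j, b j * vecOf g j i

open scoped NNReal ENNReal

lemma pi_le_smul {ι X : Type*} [Fintype ι] [MeasurableSpace X] (μ ν : Measure X)
    [SigmaFinite μ] [SigmaFinite ν] (c : ℝ≥0) (h : μ ≤ c • ν) :
    Measure.pi (fun _ : ι => μ) ≤ (c ^ Fintype.card ι) • Measure.pi (fun _ : ι => ν) := by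
  have h1 : (Measure.pi (fun _ : ι => μ)).toOuterMeasure ≤
      OuterMeasure.pi (fun _ : ι => (c • ν).toOuterMeasure) := by
    rw [OuterMeasure.le_pi]
    intro s _
    show Measure.pi (fun _ : ι => μ) (Set.pi univ s) ≤ _
    rw [Measure.pi_pi]
    exact Finset.prod_le_prod' fun i _ => h (s i)
  have h2 : Measure.pi (fun _ : ι => c • ν) = (c ^ Fintype.card ι) • Measure.pi (fun _ : ι => ν) := by
    refine Measure.pi_eq fun s hs => ?_
    simp only [Measure.smul_apply, Measure.pi_pi, ENNReal.smul_def, smul_eq_mul, Finset.prod_mul_distrib,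
      Finset.prod_const, Finset.card_univ, ENNReal.coe_pow]
  rw [← h2]
  refine Measure.le_iff.2 fun s hs => ?_
  refine (h1 s).trans ?_
  rw [Measure.pi, toMeasure_apply _ _ hs]

lemma gauss_le_s14 : gaussianReal 0 (1/2) ≤ (NNReal.sqrt (NNReal.pi))⁻¹ • (volume : Measure ℝ) := by
  rw [gaussianReal_of_var_ne_zero _ (by norm_num)]
  refine Measure.le_iff.2 fun s hs => ?_
  rw [withDensity_apply _ hs]
  calc _ ≤ ∫⁻ x in s, (((NNReal.sqrt NNReal.pi)⁻¹ : ℝ≥0) : ℝ≥0∞) := by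
        refine lintegral_mono fun x => ?_
        rw [gaussianPDF, ← ENNReal.ofReal_coe_nnreal]
        refine ENNReal.ofReal_le_ofReal ?_
        rw [gaussianPDFReal]
        have : (√(2 * Real.pi * ((1/2 : ℝ≥0) : ℝ)))⁻¹ = (((NNReal.sqrt NNReal.pi)⁻¹ : ℝ≥0) : ℝ) := by
          push_cast
          congr 2
          simp only [one_div, NNReal.coe_inv, NNReal.coe_ofNat, NNReal.coe_real_pi]
          ring
        rw [this]
        refine mul_le_of_le_one_right (by positivity) ?_
        rw [Real.exp_le_one_iff]
        have : 0 ≤ (x-0)^2 / (2 * ((1/2 : ℝ≥0) : ℝ)) := by positivity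
        rw [neg_div]; linarith
    _ = _ := by
      rw [lintegral_const, Measure.smul_apply, ENNReal.smul_def, smul_eq_mul,
        Measure.restrict_apply_univ]

def toC (h : Bool → ℝ) : ℂ := (h false : ℂ) + (h true : ℂ) * Complex.I

lemma measurable_toC : Measurable toC := by unfold toC; fun_prop

def gC : Measure ℂ := (Measure.pi (fun _ : Bool => gaussianReal 0 (1/2))).map toC

instance : IsProbabilityMeasure gC :=
  Measure.isProbabilityMeasure_map measurable_toC.aemeasurable

lemma map_toC : (volume : Measure (Bool → ℝ)).map toC = volume := by
  have h1 : (volume : Measure (Bool → ℝ)).map (fun h => (h false, h true)) = volume := by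
    refine (Measure.prod_eq fun s t hs ht => ?_).symm
    rw [Measure.map_apply (by fun_prop) (hs.prod ht)]
    have : (fun h : Bool → ℝ => (h false, h true)) ⁻¹' s ×ˢ t
        = Set.pi univ (fun b => if b then t else s) := by
      ext h
      simp
    rw [this, volume_pi, Measure.pi_pi]
    simp [mul_comm]
  have h2 : toC = Complex.measurableEquivRealProd.symm ∘ (fun h => (h false, h true)) := by
    ext h
    apply Complex.ext <;> simp [toC, Complex.measurableEquivRealProd_symm_apply]
  rw [h2, ← Measure.map_map (by fun_prop) (by fun_prop), h1]
  exact Complex.volume_preserving_equiv_real_prod.symm.map_eq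

lemma gC_le : gC ≤ NNReal.pi⁻¹ • volume := by
  have h := pi_le_smul (ι := Bool) _ _ _ gauss_le_s14
  have := Measure.map_mono h measurable_toC
  rw [Measure.map_smul, ← volume_pi, map_toC] at this
  simpa [gC] using this

def gV (M : ℕ) : Measure (Fin M → ℂ) := Measure.pi fun _ => gC

instance (M : ℕ) : IsProbabilityMeasure (gV M) := by unfold gV; infer_instance

lemma gV_le (M : ℕ) : gV M ≤ (NNReal.pi⁻¹ ^ M) • volume := by
  have := pi_le_smul (ι := Fin M) _ _ _ gC_le
  rw [Fintype.card_fin] at this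
  exact this

lemma pi_curry {ι κ X : Type*} [Fintype ι] [Fintype κ] [MeasurableSpace X] (μ : Measure X)
    [IsProbabilityMeasure μ] :
    (Measure.pi (fun _ : ι × κ => μ)).map (MeasurableEquiv.curry ι κ X) =
      Measure.pi (fun _ : ι => Measure.pi (fun _ : κ => μ)) := by
  have := Measure.infinitePi_map_curry (fun (_ : ι) (_ : κ) => μ)
  simpa only [Measure.infinitePi_eq_pi] using this

lemma map_vecOf (M : ℕ) :
    (gaussVecMeasure M).map (vecOf (M := M)) = Measure.pi fun _ : Fin M => gV M := by
  have h2 : (Measure.pi (fun _ : Fin M × Bool => gaussianReal 0 (1/2))).map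
      (fun h i => toC (fun b => h (i, b))) = gV M := by
    rw [show (fun (h : Fin M × Bool → ℝ) i => toC (fun b => h (i, b))) =
      (fun (x : Fin M → Bool → ℝ) i => toC (x i)) ∘ MeasurableEquiv.curry (Fin M) Bool ℝ from rfl,
      ← Measure.map_map (g := fun (x : Fin M → Bool → ℝ) i => toC (x i)) (measurable_pi_lambda _ fun i => measurable_toC.comp (measurable_pi_apply i))
        (MeasurableEquiv.measurable _), pi_curry]
    haveI : ∀ i : Fin M, SigmaFinite ((Measure.pi (fun _ : Bool => gaussianReal 0 (1/2))).map toC) :=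
      fun i => inferInstanceAs (SigmaFinite gC)
    exact Measure.pi_map_pi (fun _ => measurable_toC.aemeasurable)
  have hm : Measurable (fun (h : Fin M × Bool → ℝ) (i : Fin M) => toC (fun b => h (i, b))) :=
    measurable_pi_lambda _ fun i => measurable_toC.comp (by fun_prop)
  rw [show (vecOf (M := M)) = (fun (x : Fin M → Fin M × Bool → ℝ) j =>
      (fun (h : Fin M × Bool → ℝ) (i : Fin M) => toC (fun b => h (i, b))) (x j)) ∘
      MeasurableEquiv.curry (Fin M) (Fin M × Bool) ℝ from rfl,
      ← Measure.map_map (g := fun (x : Fin M → Fin M × Bool → ℝ) j =>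
      (fun (h : Fin M × Bool → ℝ) (i : Fin M) => toC (fun b => h (i, b))) (x j))
        (measurable_pi_lambda _ fun i => hm.comp (measurable_pi_apply i))
        (MeasurableEquiv.measurable _), gaussVecMeasure, pi_curry]
  haveI : ∀ i : Fin M, SigmaFinite ((Measure.pi (fun _ : Fin M × Bool => gaussianReal 0 (1/2))).map
      (fun (h : Fin M × Bool → ℝ) (i : Fin M) => toC (fun b => h (i, b)))) :=
    fun i => by rw [h2]; infer_instance
  rw [Measure.pi_map_pi (fun _ => hm.aemeasurable), h2]

lemma lint_affine {M : ℕ} (p : ℂ) (hp : p ≠ 0) (c : Fin M → ℂ) (f : (Fin M → ℂ) → ℝ≥0∞)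
    (hf : Measurable f) :
    ∫⁻ x, f (p • x + c) = ENNReal.ofReal ((‖p‖ ^ (2 * M))⁻¹) * ∫⁻ x, f x := by
  let L : (Fin M → ℂ) →ₗ[ℝ] (Fin M → ℂ) :=
    LinearMap.restrictScalars ℝ (p • (LinearMap.id : (Fin M → ℂ) →ₗ[ℂ] (Fin M → ℂ)))
  have hdet : LinearMap.det L = ‖p‖ ^ (2 * M) := by
    rw [LinearMap.det_restrictScalars, LinearMap.det_smul]
    simp [Algebra.norm_complex_eq, Complex.normSq_eq_norm_sq,
      ← pow_mul, mul_comm]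
  have hd0 : LinearMap.det L ≠ 0 := by rw [hdet]; positivity
  have h := Measure.map_linearMap_addHaar_eq_smul_addHaar (volume : Measure (Fin M → ℂ)) hd0
  rw [hdet, abs_of_nonneg (by positivity)] at h
  have hL : Measurable L := (LinearMap.continuous_of_finiteDimensional L).measurable
  calc ∫⁻ x, f (p • x + c) = ∫⁻ x, f (x + c) ∂(Measure.map L volume) := by
        rw [lintegral_map (by fun_prop) hL]; rfl
    _ = _ := by rw [h, lintegral_smul_measure, lintegral_add_right_eq_self f c]; rfl

lemma lint_two {M : ℕ} (p q r s : ℂ) (hp : p ≠ 0) (hm : 1 ≤ ‖p * s - q * r‖) (c d : Fin M → ℂ)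
    (F : (Fin M → ℂ) → ℝ≥0∞) (hF : Measurable F) :
    ∫⁻ y, ∫⁻ x, F (p • x + q • y + c) * F (r • x + s • y + d) ≤ (∫⁻ x, F x) ^ 2 := by
  have hm0 : p * s - q * r ≠ 0 := by
    intro h; rw [h] at hm; norm_num at hm
  have e1 : ∀ y, ∫⁻ x, F (p • x + q • y + c) * F (r • x + s • y + d) =
      ENNReal.ofReal ((‖p‖ ^ (2 * M))⁻¹) *
       ∫⁻ u, F u * F (((p * s - q * r) / p) • y + ((r / p) • (u - c) + d)) := by
    intro y
    rw [← lint_affine p hp (q • y + c)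
      (fun u => F u * F (((p * s - q * r) / p) • y + ((r / p) • (u - c) + d))) (by fun_prop)]
    refine lintegral_congr fun x => ?_
    rw [← add_assoc]
    congr 2
    ext i
    simp only [Pi.add_apply, Pi.smul_apply, Pi.sub_apply, smul_eq_mul]
    field_simp
    ring
  simp_rw [e1]
  rw [lintegral_const_mul' _ _ ENNReal.ofReal_ne_top, lintegral_lintegral_swap (by fun_prop)]
  have e2 : ∀ u, ∫⁻ y, F u * F (((p * s - q * r) / p) • y + ((r / p) • (u - c) + d)) =
      ENNReal.ofReal ((‖(p * s - q * r) / p‖ ^ (2 * M))⁻¹) * (∫⁻ x, F x) * F u := by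
    intro u
    rw [lintegral_const_mul _ (by fun_prop), lint_affine _ (div_ne_zero hm0 hp) _ F hF, mul_comm]
  simp_rw [e2]
  rw [lintegral_const_mul _ hF]
  rw [mul_assoc, ← mul_assoc, ← ENNReal.ofReal_mul (by positivity), ← sq]
  refine mul_le_of_le_one_left' ?_
  rw [ENNReal.ofReal_le_one, ← mul_inv, ← mul_pow, norm_div, mul_div_cancel₀ _ (norm_ne_zero_iff.2 hp)]
  exact inv_le_one_of_one_le₀ (one_le_pow₀ hm)

lemma vol_ball_s14 {M : ℕ} (hM : 2 ≤ M) (ε : ℝ) (hε : 0 < ε) :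
    volume {x : Fin M → ℂ | cnorm x ≤ ε} =
      ENNReal.ofReal (ε ^ (2 * M) * (Real.pi ^ M / (Nat.factorial M : ℝ))) := by
  have : Nonempty (Fin M) := ⟨⟨0, by omega⟩⟩
  have h := Complex.volume_sum_rpow_le (ι := Fin M) (p := 2) (by norm_num) ε
  have h3 : {x : Fin M → ℂ | cnorm x ≤ ε} =
      {x : Fin M → ℂ | (∑ i, ‖x i‖ ^ (2:ℝ)) ^ (1 / (2:ℝ)) ≤ ε} := by
    ext x
    simp [cnorm, Real.sqrt_eq_rpow]
  rw [h3, h, ENNReal.ofReal_mul (by positivity), ENNReal.ofReal_pow hε.le]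
  congr 2
  · simp
  · have : (2 : ℝ) * (Fintype.card (Fin M)) / 2 + 1 = (M : ℝ) + 1 := by simp
    rw [this, Real.Gamma_nat_eq_factorial]
    have : (2 : ℝ) / 2 + 1 = (1 : ℕ) + 1 := by norm_num
    rw [this, Real.Gamma_nat_eq_factorial]
    simp

lemma measurable_cnorm (M : ℕ) : Measurable (cnorm : (Fin M → ℂ) → ℝ) := by
  unfold cnorm; fun_prop

lemma sum_update {M : ℕ} (b : Fin M → ℂ) (w : Fin M → Fin M → ℂ) (j k : Fin M) (hjk : k ≠ j)
    (x y : Fin M → ℂ) :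
    ∑ l, b l • Function.update (Function.update w k y) j x l =
      b j • x + b k • y + ∑ l, b l • Function.update (Function.update w k 0) j 0 l := by
  have : ∀ l, b l • Function.update (Function.update w k y) j x l =
      (if l = j then b j • x else 0) + (if l = k then b k • y else 0) +
        b l • Function.update (Function.update w k 0) j 0 l := by
    intro l
    by_cases h1 : l = j
    · subst h1
      simp [hjk.symm]
    · by_cases h2 : l = k
      · subst h2
        simp [h1]
      · simp [h1, h2]
  simp_rw [this, Finset.sum_add_distrib]
  simp

lemma main_bound {M : ℕ} (a b : Fin M → ℂ) (j k : Fin M) (hj : a j ≠ 0)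
    (hm : 1 ≤ ‖a j * b k - a k * b j‖) (B : Set (Fin M → ℂ)) (hB : MeasurableSet B) :
    (Measure.pi fun _ : Fin M => gV M)
      {w | ∑ l, a l • w l ∈ B ∧ ∑ l, b l • w l ∈ B} ≤
      ENNReal.ofReal ((Real.pi ^ M)⁻¹ ^ 2) * (volume B) ^ 2 := by
  have hkj : k ≠ j := by
    rintro rfl
    rw [mul_comm, sub_self] at hm
    norm_num at hm
  set F : (Fin M → ℂ) → ℝ≥0∞ := B.indicator 1 with hFdef
  have hF : Measurable F := measurable_one.indicator hB
  have hFB : ∫⁻ x, F x = volume B := lintegral_indicator_one hB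
  have hSm : MeasurableSet {w : Fin M → Fin M → ℂ | ∑ l, a l • w l ∈ B ∧ ∑ l, b l • w l ∈ B} := by
    have h1 : ∀ a : Fin M → ℂ, Measurable (fun w : Fin M → Fin M → ℂ => ∑ l, a l • w l) := by
      intro a; fun_prop
    exact (h1 a hB).inter (h1 b hB)
  have hf : Measurable (fun w : Fin M → Fin M → ℂ => F (∑ l, a l • w l) * F (∑ l, b l • w l)) := by
    fun_prop
  have hC : ((NNReal.pi⁻¹ ^ M : ℝ≥0) : ℝ≥0∞) = ENNReal.ofReal ((Real.pi ^ M)⁻¹) := by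
    rw [← ENNReal.ofReal_coe_nnreal]; simp
  calc _ = ∫⁻ w, F (∑ l, a l • w l) * F (∑ l, b l • w l) ∂(Measure.pi fun _ : Fin M => gV M) := by
        rw [← lintegral_indicator_one hSm]
        refine lintegral_congr fun w => ?_
        by_cases h1 : ∑ l, a l • w l ∈ B <;> by_cases h2 : ∑ l, b l • w l ∈ B <;>
          simp [hFdef, Set.indicator, h1, h2]
    _ ≤ ∫⁻ w, ENNReal.ofReal ((Real.pi ^ M)⁻¹ ^ 2) * (volume B) ^ 2
          ∂(Measure.pi fun _ : Fin M => gV M) := by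
        refine lintegral_le_of_lmarginal_le ({k, j} : Finset (Fin M)) hf measurable_const ?_
        intro w
        rw [lmarginal_insert _ hf (by simpa using hkj), lmarginal_singleton]
        simp only [lmarginal, lintegral_const, measure_univ, mul_one]
        obtain ⟨c, hc⟩ : ∃ c, ∀ x y, ∑ l, a l • Function.update (Function.update w k y) j x l =
          a j • x + a k • y + c := ⟨_, fun x y => sum_update a w j k hkj x y⟩
        obtain ⟨d, hd⟩ : ∃ d, ∀ x y, ∑ l, b l • Function.update (Function.update w k y) j x l =
          b j • x + b k • y + d := ⟨_, fun x y => sum_update b w j k hkj x y⟩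
        simp only [hc, hd]
        rw [← hFB]
        calc _ ≤ ∫⁻ y, ∫⁻ x, F (a j • x + a k • y + c) * F (b j • x + b k • y + d)
                  ∂((NNReal.pi⁻¹ ^ M) • (volume : Measure (Fin M → ℂ)))
                  ∂((NNReal.pi⁻¹ ^ M) • (volume : Measure (Fin M → ℂ))) :=
              lintegral_mono' (gV_le M) fun y => lintegral_mono' (gV_le M) le_rfl
          _ = ENNReal.ofReal ((Real.pi ^ M)⁻¹ ^ 2) *
                ∫⁻ y, ∫⁻ x, F (a j • x + a k • y + c) * F (b j • x + b k • y + d) := by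
              have hs : ∀ h : (Fin M → ℂ) → ℝ≥0∞,
                  ∫⁻ x, h x ∂((NNReal.pi⁻¹ ^ M) • (volume : Measure (Fin M → ℂ))) =
                  ((NNReal.pi⁻¹ ^ M : ℝ≥0) : ℝ≥0∞) * ∫⁻ x, h x := by
                intro h
                rw [lintegral_smul_measure, ENNReal.smul_def, smul_eq_mul]
              simp_rw [hs]
              rw [lintegral_const_mul' _ _ ENNReal.coe_ne_top, hC, ← mul_assoc,
                ← ENNReal.ofReal_mul (by positivity), ← sq]
          _ ≤ _ := by
              gcongr
              exact lint_two _ _ _ _ hj hm _ _ F hF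
    _ = _ := by simp

lemma gi_norm (g : GaussianInt) (hg : (g : ℂ) ≠ 0) : 1 ≤ ‖(g : ℂ)‖ := by
  have h0 : g ≠ 0 := by rintro rfl; simp at hg
  have h1 : 1 ≤ g.norm := by
    have := GaussianInt.norm_pos.2 h0
    omega
  have h2 : ((g.norm : ℤ) : ℝ) = ‖(g : ℂ)‖ ^ 2 := by
    rw [← Complex.normSq_eq_norm_sq, GaussianInt.intCast_real_norm]
  have h3 : (1 : ℝ) ≤ ‖(g : ℂ)‖ ^ 2 := by rw [← h2]; exact_mod_cast h1
  nlinarith [norm_nonneg (g : ℂ)]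

/-- Let `M ≥ 2`, `0 < ε < 1`, and let `v₁, …, v_M` be i.i.d. standard
circularly-symmetric complex Gaussian vectors in `ℂ^M`.  If `z′, z″ ∈ ℤ[i]^M` are nonzero
Gaussian-integer vectors, `z′` is not a complex scalar multiple of `z″`, and the real and
imaginary parts of all their entries are bounded in absolute value by `ε^(−1/(2M))`, then
`Pr{‖v_{z′}‖ ≤ ε ∧ ‖v_{z″}‖ ≤ ε} ≤ ((2M)^M/(M!)²)·ε^(4M−1)`. -/
theorem joint_small_ball_upper_bound (M : ℕ) (hM : 2 ≤ M) (ε : ℝ) (hε0 : 0 < ε)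
    (hε1 : ε < 1) (z' z'' : Fin M → GaussianInt) (hz' : z' ≠ 0) (hz'' : z'' ≠ 0)
    (hprop : ¬ ∃ c : ℂ, (fun i => (z' i : ℂ)) = fun i => c * (z'' i : ℂ))
    (hbd' : ∀ i, |((z' i).re : ℝ)| ≤ ε ^ (-(1 : ℝ) / (2 * M)) ∧
                 |((z' i).im : ℝ)| ≤ ε ^ (-(1 : ℝ) / (2 * M)))
    (hbd'' : ∀ i, |((z'' i).re : ℝ)| ≤ ε ^ (-(1 : ℝ) / (2 * M)) ∧
                  |((z'' i).im : ℝ)| ≤ ε ^ (-(1 : ℝ) / (2 * M))) :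
    ((gaussVecMeasure M) {g | cnorm (vb g fun i => (z' i : ℂ)) ≤ ε ∧
        cnorm (vb g fun i => (z'' i : ℂ)) ≤ ε}).toReal ≤
      ((2 * M : ℝ) ^ M / (Nat.factorial M : ℝ) ^ 2) * ε ^ (4 * M - 1) := by
  have ht : ∀ g : GaussianInt, (g : ℂ) = 0 ↔ g = 0 := fun g => GaussianInt.toComplex_eq_zero
  obtain ⟨j, hj⟩ : ∃ j, z' j ≠ 0 := Function.ne_iff.1 hz'
  have hjc : (z' j : ℂ) ≠ 0 := fun h => hj ((ht _).1 h)
  obtain ⟨k, hk⟩ : ∃ k, (z' j : ℂ) * (z'' k : ℂ) - (z' k : ℂ) * (z'' j : ℂ) ≠ 0 := by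
    by_contra! h
    obtain ⟨i, hi⟩ : ∃ i, z'' i ≠ 0 := Function.ne_iff.1 hz''
    have hic : (z'' i : ℂ) ≠ 0 := fun h => hi ((ht _).1 h)
    have hjj : (z'' j : ℂ) ≠ 0 := by
      intro h0
      have := h i
      rw [h0, mul_zero, sub_zero] at this
      exact (mul_ne_zero hjc hic) this
    refine hprop ⟨(z' j : ℂ) / (z'' j : ℂ), ?_⟩
    ext l
    have := h l
    field_simp
    linear_combination -this
  have hm : 1 ≤ ‖(z' j : ℂ) * (z'' k : ℂ) - (z' k : ℂ) * (z'' j : ℂ)‖ := by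
    have e : ((z' j * z'' k - z' k * z'' j : GaussianInt) : ℂ) =
      (z' j : ℂ) * (z'' k : ℂ) - (z' k : ℂ) * (z'' j : ℂ) := by simp
    rw [← e] at hk ⊢
    exact gi_norm _ hk
  have hBm : MeasurableSet {x : Fin M → ℂ | cnorm x ≤ ε} :=
    measurable_cnorm M measurableSet_Iic
  have hb := main_bound (fun i => (z' i : ℂ)) (fun i => (z'' i : ℂ)) j k hjc hm _ hBm
  have hvec : Measurable (vecOf (M := M)) := by
    unfold vecOf
    fun_prop
  rw [← map_vecOf] at hb
  have hle : (gaussVecMeasure M) {g | cnorm (vb g fun i => (z' i : ℂ)) ≤ ε ∧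
        cnorm (vb g fun i => (z'' i : ℂ)) ≤ ε} ≤
      ENNReal.ofReal ((Real.pi ^ M)⁻¹ ^ 2 *
        (ε ^ (2 * M) * (Real.pi ^ M / (Nat.factorial M : ℝ))) ^ 2) := by
    rw [ENNReal.ofReal_mul (by positivity), ENNReal.ofReal_pow (by positivity) 2 (p := ε ^ (2 * M) * _),
      ← vol_ball_s14 hM ε hε0]
    refine le_trans ?_ ((Measure.le_map_apply hvec.aemeasurable _).trans hb)
    apply le_of_eq
    congr 1
    ext g
    have hv : ∀ b : Fin M → ℂ, vb g b = ∑ l, b l • vecOf g l := by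
      intro b; ext i; simp [vb]
    simp [hv]
  refine (ENNReal.toReal_le_of_le_ofReal (by positivity) hle).trans ?_
  have hpi : (Real.pi ^ M : ℝ) ≠ 0 := by positivity
  have hfac : (Nat.factorial M : ℝ) ≠ 0 := by positivity
  have e1 : (Real.pi ^ M)⁻¹ ^ 2 * (ε ^ (2 * M) * (Real.pi ^ M / (Nat.factorial M : ℝ))) ^ 2 =
      1 / (Nat.factorial M : ℝ) ^ 2 * ε ^ (4 * M) := by
    rw [show 4 * M = 2 * M * 2 by ring, pow_mul ε (2 * M) 2]
    field_simp
  rw [e1]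
  have hM1 : (1 : ℝ) ≤ 2 * M := by
    have : (2 : ℝ) ≤ M := by exact_mod_cast hM
    linarith
  have h1 : (1 : ℝ) ≤ (2 * M : ℝ) ^ M := one_le_pow₀ hM1
  have h2 : ε ^ (4 * M) ≤ ε ^ (4 * M - 1) := pow_le_pow_of_le_one hε0.le hε1.le (by omega)
  gcongr
end
end

section
/- Let M ≥ 2 and 0 < ε < 1. Let v₁, …, v_M be i.i.d. standard circularly-symmetric complex Gaussian random vectors in ℂ^M, and for z ∈ ℤ[i]^M write v_z = z₁v₁ + … + z_M v_M. Let B be the set of nonzero Gaussian-integer vectors z ∈ ℤ[i]^M whose 2M real coordinates (real and imaginary parts of the entries) have greatest common divisor 1 and are bounded in absolute value by ε^{−1/(2M)}. Then there is a constant c > 0 depending only on M such that Σ_{z ∈ B} Pr{‖v_z‖ ≤ ε} ≥ c · ε^{2M} · ln(1/ε). -/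
open MeasureTheory ProbabilityTheory Matrix Filter Set

noncomputable section

def realCoord {M : ℕ} (x y : Fin M → ℝ) (g : (Fin M × Fin M × Bool) → ℝ) : Fin M × Bool → ℝ :=
  fun p => ∑ j, (x j * g (j, p.1, p.2) +
    (if p.2 then y j * g (j, p.1, false) else - y j * g (j, p.1, true)))

lemma measurable_realCoord {M : ℕ} (x y : Fin M → ℝ) : Measurable (realCoord x y) := by
  unfold realCoord
  refine measurable_pi_lambda _ fun p => ?_
  rcases p with ⟨i, b⟩
  cases b <;> simp <;> fun_prop

lemma map_realCoord {M : ℕ} (x y : Fin M → ℝ) :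
    (gaussVecMeasure M).map (realCoord x y) =
      Measure.pi fun _ : Fin M × Bool =>
        gaussianReal 0 (Real.toNNReal ((∑ j, (x j ^ 2 + y j ^ 2)) / 2)) := by
  have : IsProbabilityMeasure (gaussVecMeasure M) := by unfold gaussVecMeasure; infer_instance
  have : IsFiniteMeasure ((gaussVecMeasure M).map (realCoord x y)) := inferInstance
  rw [← charFun_eq_pi_iff]
  intro t
  have hs : 0 ≤ (∑ j, (x j ^ 2 + y j ^ 2)) / 2 := by positivity
  let u : Fin M × Fin M × Bool → ℝ := fun q =>
    x q.1 * t (q.2.1, q.2.2) + (if q.2.2 then - y q.1 * t (q.2.1, false) else y q.1 * t (q.2.1, true))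
  have key : charFun (((gaussVecMeasure M).map (realCoord x y)).map (WithLp.toLp 2)) t
      = charFun ((gaussVecMeasure M).map (WithLp.toLp 2)) (WithLp.toLp 2 u) := by
    rw [charFun_apply, charFun_apply, integral_map (by fun_prop) (by fun_prop),
      integral_map (measurable_realCoord x y).aemeasurable (by fun_prop),
      integral_map (by fun_prop) (by fun_prop)]
    congr 1
    funext g
    congr 3
    simp only [PiLp.inner_apply, RCLike.inner_apply, conj_trivial, realCoord, u,
      Fintype.sum_prod_type, Fintype.sum_bool, Finset.mul_sum]
    simp only [← Finset.sum_add_distrib, if_true]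
    rw [Finset.sum_comm]
    refine Finset.sum_congr rfl fun i _ => ?_
    refine Finset.sum_congr rfl fun j _ => ?_
    simp
    ring
  rw [key, gaussVecMeasure, charFun_pi]
  have alg : ∑ q, u q ^ 2 = (∑ j, (x j ^ 2 + y j ^ 2)) * ∑ p, t p ^ 2 := by
    simp only [u, Fintype.sum_prod_type, Fintype.sum_bool, Finset.sum_mul]
    refine Finset.sum_congr rfl fun j _ => ?_
    rw [Finset.mul_sum]
    refine Finset.sum_congr rfl fun i _ => ?_
    simp
    ring
  simp only [charFun_gaussianReal, ← Complex.exp_sum]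
  congr 1
  simp only [Real.coe_toNNReal _ hs]
  have e1 : ∀ q, (u q : ℂ) * ((0 : ℝ) : ℂ) * Complex.I - (((1 / 2 : NNReal) : ℝ) : ℂ) * (u q : ℂ) ^ 2 / 2
      = ((- (1 / 4) * u q ^ 2 : ℝ) : ℂ) := by
    intro q; push_cast; ring
  have e2 : ∀ p, (t p : ℂ) * ((0 : ℝ) : ℂ) * Complex.I -
      (((∑ j, (x j ^ 2 + y j ^ 2)) / 2 : ℝ) : ℂ) * (t p : ℂ) ^ 2 / 2
      = ((- (1 / 4) * ((∑ j, (x j ^ 2 + y j ^ 2)) * t p ^ 2) : ℝ) : ℂ) := by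
    intro q; push_cast; ring
  simp only [e1, e2]
  rw [← Complex.ofReal_sum, ← Complex.ofReal_sum, ← Finset.mul_sum, ← Finset.mul_sum,
    ← Finset.mul_sum, alg]

lemma gaussian_Icc_lower {v : NNReal} (hv : v ≠ 0) {δ : ℝ} (hδ : 0 ≤ δ) (h : δ ^ 2 ≤ 2 * v) :
    2 * δ * ((√(2 * Real.pi * v))⁻¹ * Real.exp (-1)) ≤ ((gaussianReal 0 v) (Icc (-δ) δ)).toReal := by
  rw [gaussianReal_apply_eq_integral _ hv, ENNReal.toReal_ofReal
    (setIntegral_nonneg measurableSet_Icc fun x _ => gaussianPDFReal_nonneg _ _ _)]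
  have := setIntegral_mono_on (s := Icc (-δ) δ) (μ := volume)
    (f := fun _ => (√(2 * Real.pi * v))⁻¹ * Real.exp (-1)) (g := gaussianPDFReal 0 v)
    (integrableOn_const (by simp)) (integrable_gaussianPDFReal 0 v).integrableOn measurableSet_Icc (by
      intro x hx
      unfold gaussianPDFReal
      have hv' : (0:ℝ) < v := by positivity
      gcongr
      rw [sub_zero, neg_div, neg_le_neg_iff, div_le_one (by positivity)]
      have : x ^ 2 ≤ δ ^ 2 := sq_le_sq' hx.1 hx.2
      linarith)
  refine le_trans (le_of_eq ?_) this
  rw [setIntegral_const]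
  rw [Measure.real, Real.volume_Icc, ENNReal.toReal_ofReal (by linarith), smul_eq_mul]
  ring

lemma sum_totient_lower (N : ℕ) :
    Real.log (N + 1) / 2 ≤ ∑ n ∈ Finset.Icc 1 N, (n.totient : ℝ) / n ^ 2 := by
  have h1 := log_add_one_le_harmonic N
  have h2 : (harmonic N : ℝ) = ∑ n ∈ Finset.Icc 1 N, (n : ℝ)⁻¹ := by
    rw [harmonic_eq_sum_Icc]; push_cast; rfl
  have h3 : ∑ n ∈ Finset.Icc 1 N, (n : ℝ)⁻¹ ≤
      ∑ p ∈ Finset.Icc 1 N ×ˢ Finset.Icc 1 N, ((p.1.totient : ℝ) / p.1 ^ 2) * ((p.2 : ℝ) ^ 2)⁻¹ := by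
    have : ∀ n ∈ Finset.Icc 1 N, (n : ℝ)⁻¹ =
        ∑ p ∈ n.divisorsAntidiagonal, ((p.1.totient : ℝ) / p.1 ^ 2) * ((p.2 : ℝ) ^ 2)⁻¹ := by
      intro n hn
      have hn0 : (n:ℝ) ≠ 0 := by
        have := (Finset.mem_Icc.1 hn).1
        positivity
      have : ∀ p ∈ n.divisorsAntidiagonal, ((p.1.totient : ℝ) / p.1 ^ 2) * ((p.2 : ℝ) ^ 2)⁻¹
          = p.1.totient * ((n : ℝ) ^ 2)⁻¹ := by
        intro p hp
        rw [← (Nat.mem_divisorsAntidiagonal.1 hp).1]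
        push_cast
        rw [mul_pow, mul_inv, div_eq_mul_inv, mul_assoc]
      rw [Finset.sum_congr rfl this, ← Finset.sum_mul,
        Nat.sum_divisorsAntidiagonal (fun a _ => (a.totient : ℝ)), ← Nat.cast_sum, Nat.sum_totient]
      field_simp
    rw [Finset.sum_congr rfl this, ← Finset.sum_biUnion]
    · refine Finset.sum_le_sum_of_subset_of_nonneg ?_ fun _ _ _ => by positivity
      intro p hp
      simp only [Finset.mem_biUnion, Finset.mem_Icc, Nat.mem_divisorsAntidiagonal,
        Finset.mem_product] at hp ⊢
      obtain ⟨n, ⟨h1, h2⟩, h3, h4⟩ := hp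
      have a : 0 < p.1 := Nat.pos_of_ne_zero (by rintro h; simp [h] at h3; omega)
      have b : 0 < p.2 := Nat.pos_of_ne_zero (by rintro h; simp [h] at h3; omega)
      exact ⟨⟨a, by nlinarith⟩, ⟨b, by nlinarith⟩⟩
    · intro a _ b _ hab
      refine Finset.disjoint_left.2 fun p hp hq => hab ?_
      rw [← (Nat.mem_divisorsAntidiagonal.1 hp).1, ← (Nat.mem_divisorsAntidiagonal.1 hq).1]
  rw [Finset.sum_product] at h3
  simp only [← Finset.mul_sum] at h3
  rw [← Finset.sum_mul] at h3
  have h4 : ∑ i ∈ Finset.Icc 1 N, ((i:ℝ) ^ 2)⁻¹ ≤ 2 := by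
    have := sum_Ioo_inv_sq_le (α := ℝ) 0 (N+1)
    have e : Finset.Ioo 0 (N+1) = Finset.Icc 1 N := by ext; simp; omega
    rw [e] at this
    simpa using this
  have h5 : 0 ≤ ∑ n ∈ Finset.Icc 1 N, (n.totient : ℝ) / n ^ 2 := by positivity
  push_cast at h1
  nlinarith

def kap (M : ℕ) : ℝ := 2 / √(2 * M) * ((√(2 * Real.pi * M))⁻¹ * Real.exp (-1))

lemma kap_pos {M : ℕ} (hM : 2 ≤ M) : 0 < kap M := by
  have : (0:ℝ) < M := by positivity
  unfold kap
  positivity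

lemma vb_eq {M : ℕ} (g : (Fin M × Fin M × Bool) → ℝ) (z : Fin M → GaussianInt) (i : Fin M) :
    vb g (fun i => (z i : ℂ)) i =
      (realCoord (fun j => ((z j).re : ℝ)) (fun j => ((z j).im : ℝ)) g (i, false) : ℂ) +
      (realCoord (fun j => ((z j).re : ℝ)) (fun j => ((z j).im : ℝ)) g (i, true) : ℂ) * Complex.I := by
  simp only [vb, vecOf, realCoord, GaussianInt.toComplex_def]
  push_cast
  rw [Finset.sum_mul, ← Finset.sum_add_distrib]
  refine Finset.sum_congr rfl fun j _ => ?_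
  simp
  linear_combination ((z j).im : ℂ) * (g (j, i, true) : ℂ) * Complex.I_mul_I

lemma prob_lower {M : ℕ} (hM : 2 ≤ M) {ε : ℝ} (h0 : 0 < ε) (h1 : ε < 1) (n : ℕ) (hn : 1 ≤ n)
    (z : Fin M → GaussianInt) (hz : z ≠ 0)
    (hb : ∀ i, |((z i).re : ℝ)| ≤ n ∧ |((z i).im : ℝ)| ≤ n) :
    (kap M * (ε / n)) ^ (2 * M) ≤
      ((gaussVecMeasure M) {g | cnorm (vb g fun i => (z i : ℂ)) ≤ ε}).toReal := by
  have hM0 : (2:ℝ) ≤ M := by exact_mod_cast hM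
  have hMp : (0:ℝ) < M := by linarith
  have hn0 : (0:ℝ) < n := by positivity
  have : IsProbabilityMeasure (gaussVecMeasure M) := by unfold gaussVecMeasure; infer_instance
  set x : Fin M → ℝ := fun j => ((z j).re : ℝ) with hx
  set y : Fin M → ℝ := fun j => ((z j).im : ℝ) with hy
  set s : ℝ := ∑ j, (x j ^ 2 + y j ^ 2) with hs
  set δ : ℝ := ε / √(2 * M) with hδ
  have hδ0 : 0 < δ := by positivity
  have hδ2 : 2 * M * δ ^ 2 = ε ^ 2 := by
    rw [hδ, div_pow, Real.sq_sqrt (by positivity)]; field_simp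
  have hs1 : 1 ≤ s := by
    have : ∃ j, z j ≠ 0 := by
      by_contra! h; exact hz (funext h)
    obtain ⟨j, hj⟩ := this
    have h2 : (1:ℤ) ≤ (z j).re ^ 2 + (z j).im ^ 2 := by
      by_contra! h
      apply hj
      have a : (z j).re ^ 2 = 0 := by nlinarith [sq_nonneg (z j).re, sq_nonneg (z j).im]
      have b : (z j).im ^ 2 = 0 := by nlinarith [sq_nonneg (z j).re, sq_nonneg (z j).im]
      exact Zsqrtd.ext (by simpa using a) (by simpa using b)
    have h3 : (1:ℝ) ≤ x j ^ 2 + y j ^ 2 := by simp only [hx, hy]; exact_mod_cast h2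
    refine h3.trans ?_
    exact Finset.single_le_sum (f := fun j => x j ^ 2 + y j ^ 2) (fun _ _ => by positivity)
      (Finset.mem_univ j)
  have hs2 : s ≤ 2 * M * n ^ 2 := by
    have : s ≤ ∑ _j : Fin M, 2 * (n:ℝ) ^ 2 := by
      refine Finset.sum_le_sum fun j _ => ?_
      have a : x j ^ 2 ≤ (n:ℝ) ^ 2 := sq_le_sq' (abs_le.1 (hb j).1).1 (abs_le.1 (hb j).1).2
      have b : y j ^ 2 ≤ (n:ℝ) ^ 2 := sq_le_sq' (abs_le.1 (hb j).2).1 (abs_le.1 (hb j).2).2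
      linarith
    refine this.trans (le_of_eq ?_)
    simp
    ring
  set v : NNReal := Real.toNNReal (s / 2) with hv
  have hvs : (v : ℝ) = s / 2 := Real.coe_toNNReal _ (by linarith)
  have hv0 : v ≠ 0 := by
    intro h
    rw [h] at hvs
    simp at hvs
    linarith
  have hsub : (realCoord x y) ⁻¹' (Set.pi univ fun _ => Icc (-δ) δ) ⊆
      {g | cnorm (vb g fun i => (z i : ℂ)) ≤ ε} := by
    intro g hg
    simp only [Set.mem_preimage, Set.mem_pi, Set.mem_univ, true_imp_iff] at hg
    simp only [Set.mem_ofPred_eq, cnorm]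
    rw [Real.sqrt_le_left h0.le]
    have : ∀ i ∈ Finset.univ, ‖vb g (fun i => (z i : ℂ)) i‖ ^ 2 ≤ 2 * δ ^ 2 := by
      intro i _
      rw [vb_eq, ← Complex.normSq_eq_norm_sq, Complex.normSq_add_mul_I]
      have a := sq_le_sq' (hg (i, false)).1 (hg (i, false)).2
      have b := sq_le_sq' (hg (i, true)).1 (hg (i, true)).2
      linarith
    refine (Finset.sum_le_sum this).trans (le_of_eq ?_)
    rw [← hδ2]; simp; ring
  have hmeas : ((gaussVecMeasure M) ((realCoord x y) ⁻¹' (Set.pi univ fun _ => Icc (-δ) δ))).toReal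
      = ((gaussianReal 0 v) (Icc (-δ) δ)).toReal ^ (2 * M) := by
    rw [← Measure.map_apply (measurable_realCoord x y)
      (MeasurableSet.univ_pi fun _ => measurableSet_Icc), map_realCoord, Measure.pi_pi]
    simp [ENNReal.toReal_pow, mul_comm, hv, hs]
  refine le_trans ?_ (ENNReal.toReal_mono (measure_ne_top _ _) (measure_mono hsub))
  rw [hmeas]
  have hk := kap_pos hM
  refine pow_le_pow_left₀ (by positivity) (le_trans ?_ (gaussian_Icc_lower hv0 hδ0.le ?_)) _
  · have e : √(2 * Real.pi * v) ≤ √(2 * Real.pi * M) * n := by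
      rw [Real.sqrt_le_left (by positivity), mul_pow, Real.sq_sqrt (by positivity), hvs]
      have := Real.pi_pos
      nlinarith
    have e' : (√(2 * Real.pi * M) * n)⁻¹ ≤ (√(2 * Real.pi * v))⁻¹ := by
      have : 0 < (v:ℝ) := by positivity
      have := Real.pi_pos
      gcongr
    calc kap M * (ε / n) = 2 * δ * ((√(2 * Real.pi * M) * n)⁻¹ * Real.exp (-1)) := by
          rw [kap, hδ, mul_inv]; ring
      _ ≤ _ := by gcongr
  · rw [hvs]
    nlinarith

abbrev Idx (k : ℕ) := Σ _ : ℕ, ℕ × (Fin k → ℕ × ℕ)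

def mkz {k : ℕ} (p : Idx k) : Fin (k + 1) → GaussianInt :=
  Fin.cons ⟨p.1, p.2.1⟩ fun j => ⟨(p.2.2 j).1, (p.2.2 j).2⟩

lemma mkz_inj {k : ℕ} : Function.Injective (mkz (k := k)) := by
  rintro ⟨n, a, w⟩ ⟨n', a', w'⟩ h
  have h0 := congrFun h 0
  simp [mkz, Zsqrtd.ext_iff] at h0
  obtain ⟨rfl, rfl⟩ := h0
  have : w = w' := by
    funext j
    have := congrFun h j.succ
    simp [mkz, Zsqrtd.ext_iff] at this
    exact Prod.ext this.1 this.2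
  rw [this]

def idx (k N : ℕ) : Finset (Idx k) :=
  (Finset.Icc 1 N).sigma fun n =>
    (Finset.filter n.Coprime (Finset.range n)) ×ˢ
      Fintype.piFinset fun _ : Fin k => Finset.range n ×ˢ Finset.range n

lemma finite_box (M : ℕ) (R : ℝ) :
    {z : Fin M → GaussianInt | ∀ i, |((z i).re : ℝ)| ≤ R ∧ |((z i).im : ℝ)| ≤ R}.Finite := by
  have h1 : ((fun p : ℤ × ℤ => (⟨p.1, p.2⟩ : GaussianInt)) ''
      ((Set.Icc (-⌊R⌋) ⌊R⌋) ×ˢ (Set.Icc (-⌊R⌋) ⌊R⌋))).Finite :=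
    ((Set.finite_Icc _ _).prod (Set.finite_Icc _ _)).image _
  refine (Set.Finite.pi' (fun _ : Fin M => h1)).subset ?_
  intro z hz i
  have key : ∀ a : ℤ, |(a:ℝ)| ≤ R → a ∈ Set.Icc (-⌊R⌋) ⌊R⌋ := by
    intro a ha
    have : |a| ≤ ⌊R⌋ := Int.le_floor.2 (by push_cast; exact ha)
    exact abs_le.1 this
  exact ⟨((z i).re, (z i).im), ⟨key _ (hz i).1, key _ (hz i).2⟩, rfl⟩

theorem sum_small_ball_lower_bound (M : ℕ) (hM : 2 ≤ M) :
    ∃ c : ℝ, 0 < c ∧ ∀ ε : ℝ, 0 < ε → ε < 1 →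
      c * ε ^ (2 * M) * Real.log (1 / ε) ≤
        ∑' z : {z : Fin M → GaussianInt // z ≠ 0 ∧
            (Finset.univ.gcd fun i => Nat.gcd (z i).re.natAbs (z i).im.natAbs) = 1 ∧
            ∀ i, |((z i).re : ℝ)| ≤ ε ^ (-(1 : ℝ) / (2 * M)) ∧
                 |((z i).im : ℝ)| ≤ ε ^ (-(1 : ℝ) / (2 * M))},
          ((gaussVecMeasure M) {g | cnorm (vb g fun i => (z.1 i : ℂ)) ≤ ε}).toReal := by
  have hMp : (0:ℝ) < M := by positivity
  refine ⟨kap M ^ (2 * M) / (4 * M), by have := kap_pos hM; positivity, fun ε h0 h1 => ?_⟩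
  have hk := kap_pos hM
  set R : ℝ := ε ^ (-(1 : ℝ) / (2 * M)) with hR
  have hR0 : 0 < R := Real.rpow_pos_of_pos h0 _
  have hlogR : Real.log (1 / ε) = 2 * M * Real.log R := by
    rw [hR, Real.log_rpow h0, one_div, Real.log_inv]; field_simp
  set N : ℕ := ⌊R⌋₊ with hN
  have hlogN : Real.log R ≤ Real.log (N + 1) :=
    Real.log_le_log hR0 (Nat.lt_floor_add_one R).le
  have htot := sum_totient_lower N
  set B : Set (Fin M → GaussianInt) := {z | z ≠ 0 ∧
            (Finset.univ.gcd fun i => Nat.gcd (z i).re.natAbs (z i).im.natAbs) = 1 ∧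
            ∀ i, |((z i).re : ℝ)| ≤ R ∧ |((z i).im : ℝ)| ≤ R} with hB
  set F : (Fin M → GaussianInt) → ℝ := fun z =>
    ((gaussVecMeasure M) {g | cnorm (vb g fun i => (z i : ℂ)) ≤ ε}).toReal with hF
  change _ ≤ ∑' z : B, F z
  obtain ⟨k, rfl⟩ : ∃ k, M = k + 1 := ⟨M - 1, by omega⟩
  have hfin : B.Finite := (finite_box (k+1) R).subset fun z hz => hz.2.2
  have hmem : ∀ p ∈ idx k N, (1 ≤ p.1 ∧ p.1 ≤ N) ∧ mkz p ≠ 0 ∧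
      (Finset.univ.gcd fun i => Nat.gcd (mkz p i).re.natAbs (mkz p i).im.natAbs) = 1 ∧
      ∀ i, |((mkz p i).re : ℝ)| ≤ p.1 ∧ |((mkz p i).im : ℝ)| ≤ p.1 := by
    rintro ⟨n, a, w⟩ hp
    simp only [idx, Finset.mem_sigma, Finset.mem_Icc, Finset.mem_product, Finset.mem_filter,
      Finset.mem_range, Fintype.mem_piFinset] at hp
    obtain ⟨hn, ⟨ha, hc⟩, hw⟩ := hp
    refine ⟨hn, ?_, ?_, ?_⟩
    · intro h
      have := congrFun h 0
      simp [mkz, Zsqrtd.ext_iff] at this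
      omega
    · have hd : (Finset.univ.gcd fun i => Nat.gcd (mkz (k := k) ⟨n, a, w⟩ i).re.natAbs
          (mkz (k := k) ⟨n, a, w⟩ i).im.natAbs) ∣ 1 := by
        refine (Finset.gcd_dvd (Finset.mem_univ 0)).trans ?_
        simp only [mkz, Fin.cons_zero, Int.natAbs_natCast]
        rw [Nat.Coprime.gcd_eq_one hc]
      exact Nat.dvd_one.1 hd
    · intro i
      refine Fin.cases ?_ (fun j => ?_) i
      · simp [mkz]; exact ha.le
      · simp [mkz]; exact ⟨(hw j).1.le, (hw j).2.le⟩
  rw [tsum_subtype]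
  have hsum : Summable (B.indicator F) :=
    summable_of_hasFiniteSupport (hfin.subset (by simp))
  have hnonneg : ∀ z, 0 ≤ B.indicator F z := fun z =>
    Set.indicator_nonneg (fun _ _ => ENNReal.toReal_nonneg) z
  refine le_trans ?_ (hsum.sum_le_tsum ((idx k N).image mkz) fun z _ => hnonneg z)
  rw [Finset.sum_image mkz_inj.injOn]
  have hterm : ∀ p ∈ idx k N, (kap (k+1) * (ε / p.1)) ^ (2 * (k+1)) ≤ B.indicator F (mkz p) := by
    intro p hp
    obtain ⟨⟨hn1, hn2⟩, hz, hg, hb⟩ := hmem p hp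
    have hnR : (p.1 : ℝ) ≤ R := (Nat.cast_le.2 hn2).trans (Nat.floor_le hR0.le)
    rw [Set.indicator_of_mem (show mkz p ∈ B from
      ⟨hz, hg, fun i => ⟨(hb i).1.trans hnR, (hb i).2.trans hnR⟩⟩)]
    exact prob_lower hM h0 h1 p.1 hn1 _ hz hb
  refine le_trans ?_ (Finset.sum_le_sum hterm)
  have hval : ∑ p ∈ idx k N, (kap (k+1) * (ε / p.1)) ^ (2 * (k+1)) =
      (kap (k+1) * ε) ^ (2 * (k+1)) * ∑ n ∈ Finset.Icc 1 N, (n.totient : ℝ) / n ^ 2 := by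
    rw [idx, Finset.sum_sigma, Finset.mul_sum]
    refine Finset.sum_congr rfl fun n hn => ?_
    have hn0 : (n:ℝ) ≠ 0 := by
      have := (Finset.mem_Icc.1 hn).1
      positivity
    dsimp only
    rw [Finset.sum_const, Finset.card_product, Fintype.card_piFinset]
    simp only [Finset.card_product, Finset.card_range, Finset.prod_const, Finset.card_univ,
      Fintype.card_fin, nsmul_eq_mul]
    rw [← Nat.totient]
    push_cast
    rw [← pow_two, ← pow_mul, ← mul_div_assoc, div_pow, mul_add 2 k 1, mul_one, pow_add (n:ℝ)]
    field_simp
  rw [hval, hlogR, mul_pow]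
  calc _ = kap (k+1) ^ (2 * (k+1)) * ε ^ (2 * (k+1)) * (Real.log R / 2) := by
        push_cast at hMp ⊢
        field_simp
        ring
    _ ≤ _ := by
        gcongr
        linarith
end
end

section
/- Let M ≥ 2 and 0 < ε < 1, with v₁, …, v_M i.i.d. standard circularly-symmetric complex Gaussian vectors in ℂ^M and v_z = z₁v₁ + … + z_M v_M for z ∈ ℤ[i]^M. Let B be the set of nonzero Gaussian-integer vectors z ∈ ℤ[i]^M whose 2M real coordinates have greatest common divisor 1 and are bounded in absolute value by ε^{−1/(2M)}. Then there is a constant c > 0 depending only on M such that the sum of Pr{‖v_{z′}‖ ≤ ε and ‖v_{z″}‖ ≤ ε} over all pairs (z′, z″) of elements of B with z′ not a complex scalar multiple of z″ is at most c · ε^{4M−3}. -/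
open MeasureTheory ProbabilityTheory Matrix Filter Set

noncomputable section

lemma aux_gauss_le : gaussianReal 0 (1/2) ≤ (volume : Measure ℝ) := by
  rw [gaussianReal_of_var_ne_zero _ (by norm_num)]
  refine Measure.le_intro fun s hs _ => ?_
  rw [withDensity_apply _ hs]
  calc ∫⁻ x in s, gaussianPDF 0 (1/2) x ≤ ∫⁻ x in s, 1 := by
        refine lintegral_mono fun x => ?_
        rw [gaussianPDF, ENNReal.ofReal_le_one, gaussianPDFReal]
        refine mul_le_one₀ ?_ (Real.exp_nonneg _) ?_
        · apply inv_le_one_of_one_le₀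
          rw [Real.one_le_sqrt]
          have := Real.pi_gt_three
          push_cast
          linarith
        · rw [Real.exp_le_one_iff]
          apply div_nonpos_of_nonpos_of_nonneg
          · have := sq_nonneg (x - 0); linarith
          · positivity
    _ = volume s := by simp

lemma aux_step {ι : Type*} [Fintype ι] (p : ι → Prop) [DecidablePred p]
    (E F : Set (ι → ℝ)) (hE : MeasurableSet E) (hF : MeasurableSet F)
    (hFi : ∀ g g' : ι → ℝ, (∀ i, ¬ p i → g i = g' i) → g ∈ F → g' ∈ F)
    (f : (ι → ℝ) → ι → ℝ)
    (hf : ∀ g g' : ι → ℝ, (∀ i, ¬ p i → g i = g' i) → f g = f g')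
    (r : ℝ) (hEF : E ⊆ F) (hr : ∀ g ∈ E, ∀ i, p i → |g i - f g i| ≤ r) :
    (Measure.pi fun _ : ι => gaussianReal 0 (1/2)) E ≤
      ENNReal.ofReal (2 * r) ^ (Fintype.card {i // p i}) *
      (Measure.pi fun _ : ι => gaussianReal 0 (1/2)) F := by
  have mp := (measurePreserving_piEquivPiSubtypeProd (fun _ : ι => gaussianReal 0 (1/2)) p).symm
  set e := MeasurableEquiv.piEquivPiSubtypeProd (fun _ : ι => ℝ) p with he
  have ep : ∀ x y i (hi : p i), e.symm (x, y) i = x ⟨i, hi⟩ := by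
    intro x y i hi
    simp [he, MeasurableEquiv.piEquivPiSubtypeProd, Equiv.piEquivPiSubtypeProd, hi]
  have en : ∀ x y i (hi : ¬ p i), e.symm (x, y) i = y ⟨i, hi⟩ := by
    intro x y i hi
    simp [he, MeasurableEquiv.piEquivPiSubtypeProd, Equiv.piEquivPiSubtypeProd, hi]
  have inv : ∀ x x' y i, ¬ p i → e.symm (x, y) i = e.symm (x', y) i := by
    intro x x' y i hi
    rw [en _ _ _ hi, en _ _ _ hi]
  rw [← mp.measure_preimage hE.nullMeasurableSet, ← mp.measure_preimage hF.nullMeasurableSet]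
  rw [Measure.prod_apply_symm (e.symm.measurable hE), Measure.prod_apply_symm (e.symm.measurable hF)]
  rw [← lintegral_const_mul' _ _ (by finiteness)]
  refine lintegral_mono fun y => ?_
  by_cases hy : e.symm (0, y) ∈ F
  · have h1 : (fun x => (x, y)) ⁻¹' (⇑e.symm ⁻¹' F) = univ := by
      ext x
      simp only [mem_preimage, mem_univ, iff_true]
      exact hFi _ _ (inv _ _ y) hy
    rw [h1, measure_univ, mul_one]
    have h2 : (fun x => (x, y)) ⁻¹' (⇑e.symm ⁻¹' E) ⊆
        Set.pi univ fun s => Icc (f (e.symm (0, y)) s - r) (f (e.symm (0, y)) s + r) := by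
      intro x hx s _
      have := hr _ hx s s.2
      rw [ep _ _ _ s.2, hf _ _ (inv x 0 y), abs_le] at this
      constructor <;> linarith [this.1, this.2]
    refine (measure_mono h2).trans ?_
    rw [Measure.pi_pi]
    refine (Finset.prod_le_prod' (g := fun _ => ENNReal.ofReal (2 * r)) fun s _ => ?_).trans ?_
    · refine (aux_gauss_le _).trans ?_
      rw [Real.volume_Icc]
      apply le_of_eq; congr 1; ring
    · simp
  · have : (fun x => (x, y)) ⁻¹' (⇑e.symm ⁻¹' E) = ∅ := by
      ext x
      simp only [mem_preimage, mem_empty_iff_false, iff_false]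
      intro hx
      exact hy (hFi _ _ (inv _ _ y) (hEF hx))
    rw [this]; simp

lemma aux_vb_cont {M : ℕ} (Y : Fin M → ℂ) (i : Fin M) :
    Continuous fun g : (Fin M × Fin M × Bool) → ℝ => vb g Y i := by
  unfold vb vecOf
  fun_prop

lemma aux_row {M : ℕ} (Y : Fin M → ℂ) (k : Fin M) (hk : Y k ≠ 0) (ρ : ℝ)
    (E F : Set ((Fin M × Fin M × Bool) → ℝ)) (hE : MeasurableSet E) (hF : MeasurableSet F)
    (hFi : ∀ g g' : (Fin M × Fin M × Bool) → ℝ, (∀ i, ¬ i.1 = k → g i = g' i) → g ∈ F → g' ∈ F)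
    (hEF : E ⊆ F) (hr : ∀ g ∈ E, ∀ i, ‖vb g Y i‖ ≤ ρ) :
    gaussVecMeasure M E ≤ ENNReal.ofReal (2 * (ρ / ‖Y k‖)) ^ (2 * M) * gaussVecMeasure M F := by
  have hcard : Fintype.card {i : Fin M × Fin M × Bool // i.1 = k} = 2 * M := by
    have : {i : Fin M × Fin M × Bool // i.1 = k} ≃ Fin M × Bool :=
      { toFun := fun i => i.1.2
        invFun := fun x => ⟨(k, x), rfl⟩
        left_inv := by rintro ⟨⟨a, b⟩, rfl⟩; rfl
        right_inv := fun x => rfl }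
    rw [Fintype.card_congr this]; simp [mul_comm]
  rw [← hcard]
  refine aux_step (fun i : Fin M × Fin M × Bool => i.1 = k) E F hE hF hFi
    (fun g i => bif i.2.2 then (vecOf g k i.2.1 - vb g Y i.2.1 / Y k).im
      else (vecOf g k i.2.1 - vb g Y i.2.1 / Y k).re) ?_ _ hEF ?_
  · intro g g' h
    have key : ∀ i, vecOf g k i - vb g Y i / Y k = vecOf g' k i - vb g' Y i / Y k := by
      intro i
      have e1 : ∀ g : (Fin M × Fin M × Bool) → ℝ, vecOf g k i - vb g Y i / Y k =
          - (∑ j ∈ Finset.univ.erase k, Y j * vecOf g j i) / Y k := by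
        intro g
        rw [vb, ← Finset.add_sum_erase _ _ (Finset.mem_univ k)]
        field_simp
        ring
      rw [e1, e1]
      congr 2
      refine Finset.sum_congr rfl fun j hj => ?_
      have hjk := Finset.ne_of_mem_erase hj
      simp only [vecOf]
      rw [h _ (by exact hjk), h _ (by exact hjk)]
    funext i
    simp only [key]
  · rintro g hg ⟨k', i, b⟩ hkk
    simp only at hkk
    subst hkk
    have h1 : ‖vb g Y i / Y k'‖ ≤ ρ / ‖Y k'‖ := by
      rw [norm_div]
      exact div_le_div_of_nonneg_right (hr g hg i) (norm_nonneg _)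
    cases b
    · refine le_trans ?_ h1
      refine le_trans (le_of_eq ?_) (Complex.abs_re_le_norm _)
      simp [vecOf]
    · refine le_trans ?_ h1
      refine le_trans (le_of_eq ?_) (Complex.abs_im_le_norm _)
      simp [vecOf]

lemma aux_pair0 {M : ℕ} (Z W : Fin M → ℂ) (j k : Fin M) (hD : 1 ≤ ‖Z j * W k - W j * Z k‖)
    (hjk : ‖W j‖ ≤ ‖Z j‖) (ε : ℝ) (hε : 0 < ε) :
    gaussVecMeasure M {g | ∀ i, ‖vb g Z i‖ ≤ ε ∧ ‖vb g W i‖ ≤ ε} ≤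
      ENNReal.ofReal ((8 * ε ^ 2) ^ (2 * M)) := by
  have hZj : Z j ≠ 0 := by
    intro h0
    have : W j = 0 := by simpa [h0] using hjk
    norm_num [h0, this] at hD
  have hZp : 0 < ‖Z j‖ := norm_pos_iff.2 hZj
  set Y : Fin M → ℂ := fun l => Z j * W l - W j * Z l with hY
  have hYk : Y k ≠ 0 := by
    intro h0
    have : Z j * W k - W j * Z k = 0 := h0
    norm_num [this] at hD
  have hYj : Y j = 0 := by simp [hY]; ring
  have hvY : ∀ g i, vb g Y i = Z j * vb g W i - W j * vb g Z i := by
    intro g i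
    simp only [vb, hY, Finset.mul_sum, ← Finset.sum_sub_distrib]
    exact Finset.sum_congr rfl fun l _ => by ring
  have mE : MeasurableSet {g : (Fin M × Fin M × Bool) → ℝ | ∀ i, ‖vb g Z i‖ ≤ ε ∧ ‖vb g W i‖ ≤ ε} := by
    simp only [setOf_forall, setOf_and]
    exact MeasurableSet.iInter fun i =>
      (isClosed_le (aux_vb_cont Z i).norm continuous_const).measurableSet.inter
      (isClosed_le (aux_vb_cont W i).norm continuous_const).measurableSet
  have mF : MeasurableSet {g : (Fin M × Fin M × Bool) → ℝ | ∀ i, ‖vb g Y i‖ ≤ 2 * ε * ‖Z j‖} := by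
    simp only [setOf_forall]
    exact MeasurableSet.iInter fun i =>
      (isClosed_le (aux_vb_cont Y i).norm continuous_const).measurableSet
  have s1 := aux_row Z j hZj ε _ {g | ∀ i, ‖vb g Y i‖ ≤ 2 * ε * ‖Z j‖} mE mF ?_ ?_
    (fun g hg i => (hg i).1)
  · have s2 := aux_row Y k hYk (2 * ε * ‖Z j‖) _ univ mF MeasurableSet.univ
      (fun _ _ _ _ => mem_univ _) (subset_univ _) (fun g hg i => hg i)
    have : IsProbabilityMeasure (gaussVecMeasure M) := by unfold gaussVecMeasure; infer_instance
    rw [measure_univ, mul_one] at s2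
    refine s1.trans ((mul_le_mul_right s2 _).trans ?_)
    have hYp : 1 ≤ ‖Y k‖ := hD
    rw [← mul_pow, ← ENNReal.ofReal_mul (by positivity), ← ENNReal.ofReal_pow (by positivity)]
    apply ENNReal.ofReal_le_ofReal
    apply pow_le_pow_left₀ (by positivity)
    have : 2 * (ε / ‖Z j‖) * (2 * (2 * ε * ‖Z j‖ / ‖Y k‖)) = 8 * ε ^ 2 / ‖Y k‖ := by
      field_simp; ring
    rw [this]
    exact div_le_self (by positivity) hYp
  · intro g g' h hg i
    have : vb g' Y i = vb g Y i := by
      simp only [vb]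
      refine Finset.sum_congr rfl fun l _ => ?_
      by_cases hl : l = j
      · rw [hl, hYj]; simp
      · simp only [vecOf]
        rw [h _ (by exact hl), h _ (by exact hl)]
    rw [this]; exact hg i
  · intro g hg i
    rw [hvY]
    refine (norm_sub_le _ _).trans ?_
    rw [norm_mul, norm_mul]
    have h1 := mul_le_mul_of_nonneg_left (hg i).2 hZp.le
    have h2 := mul_le_mul hjk (hg i).1 (norm_nonneg _) hZp.le
    linarith

lemma aux_pair {M : ℕ} (Z W : Fin M → ℂ) (j k : Fin M) (hD : 1 ≤ ‖Z j * W k - W j * Z k‖)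
    (ε : ℝ) (hε : 0 < ε) :
    gaussVecMeasure M {g | cnorm (vb g Z) ≤ ε ∧ cnorm (vb g W) ≤ ε} ≤
      ENNReal.ofReal ((8 * ε ^ 2) ^ (2 * M)) := by
  have hc : ∀ (v : Fin M → ℂ) i, ‖v i‖ ≤ cnorm v := by
    intro v i
    refine Real.le_sqrt_of_sq_le ?_
    exact Finset.single_le_sum (f := fun i => ‖v i‖ ^ 2) (fun _ _ => by positivity) (Finset.mem_univ i)
  rcases le_total ‖W j‖ ‖Z j‖ with h | h
  · refine le_trans (measure_mono ?_) (aux_pair0 Z W j k hD h ε hε)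
    exact fun g hg i => ⟨(hc _ i).trans hg.1, (hc _ i).trans hg.2⟩
  · refine le_trans (measure_mono ?_) (aux_pair0 W Z j k (by rwa [norm_sub_rev]) h ε hε)
    exact fun g hg i => ⟨(hc _ i).trans hg.2, (hc _ i).trans hg.1⟩

lemma aux_norm (d : GaussianInt) (hd : d ≠ 0) : 1 ≤ ‖(d : ℂ)‖ := by
  have h1 : (0:ℤ) < d.norm := GaussianInt.norm_pos.2 hd
  have h2 : (1:ℝ) ≤ Complex.normSq (d : ℂ) := by
    rw [← GaussianInt.intCast_real_norm]; exact_mod_cast h1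
  rw [Complex.normSq_eq_norm_sq] at h2
  nlinarith [norm_nonneg (d : ℂ)]

lemma aux_minor {M : ℕ} (z w : Fin M → GaussianInt) (hw : w ≠ 0)
    (h : ¬ ∃ c : ℂ, (fun i => (z i : ℂ)) = fun i => c * (w i : ℂ)) :
    ∃ j k, 1 ≤ ‖(z j : ℂ) * (w k : ℂ) - (w j : ℂ) * (z k : ℂ)‖ := by
  obtain ⟨k, hk⟩ := Function.ne_iff.1 hw
  by_contra! hcon
  apply h
  have hk' : (w k : ℂ) ≠ 0 := by
    intro h0; exact hk (GaussianInt.toComplex_eq_zero.1 h0)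
  refine ⟨(z k : ℂ) / (w k : ℂ), funext fun j => ?_⟩
  have h0 : z j * w k - w j * z k = 0 := by
    by_contra hne
    have := aux_norm _ hne
    simp only [map_sub, map_mul] at this
    exact absurd this (not_le.2 (hcon j k))
  have h1 : (z j : ℂ) * (w k : ℂ) - (w j : ℂ) * (z k : ℂ) = 0 := by
    rw [← map_mul, ← map_mul, ← map_sub, h0, map_zero]
  field_simp
  linear_combination h1

lemma aux_card {M : ℕ} (R : ℝ) (hR : 1 ≤ R)
    (P : (Fin M → GaussianInt) × (Fin M → GaussianInt) → Prop)
    (hP : ∀ p, P p → (∀ i, |((p.1 i).re : ℝ)| ≤ R ∧ |((p.1 i).im : ℝ)| ≤ R) ∧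
      (∀ i, |((p.2 i).re : ℝ)| ≤ R ∧ |((p.2 i).im : ℝ)| ≤ R)) :
    Finite {p // P p} ∧ (Nat.card {p // P p} : ℝ) ≤ (3 * R) ^ (4 * M) := by
  set N : ℤ := ⌊R⌋ with hN
  have hI : ∀ x : ℤ, |(x : ℝ)| ≤ R → x ∈ Finset.Icc (-N) N := by
    intro x hx
    have : |x| ≤ N := by rw [hN, Int.le_floor]; exact_mod_cast hx
    rw [Finset.mem_Icc]; exact abs_le.1 this
  let T := Finset.Icc (-N) N
  let φ : {p // P p} → (Fin M → T × T) × (Fin M → T × T) := fun p =>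
    (fun i => (⟨(p.1.1 i).re, hI _ ((hP _ p.2).1 i).1⟩, ⟨(p.1.1 i).im, hI _ ((hP _ p.2).1 i).2⟩),
     fun i => (⟨(p.1.2 i).re, hI _ ((hP _ p.2).2 i).1⟩, ⟨(p.1.2 i).im, hI _ ((hP _ p.2).2 i).2⟩))
  have hφ : Function.Injective φ := by
    rintro ⟨⟨a, b⟩, hp⟩ ⟨⟨a', b'⟩, hp'⟩ h
    simp only [φ, Prod.mk.injEq, funext_iff, Subtype.mk.injEq] at h
    have ha : a = a' := funext fun i => Zsqrtd.ext (h.1 i).1 (h.1 i).2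
    have hb : b = b' := funext fun i => Zsqrtd.ext (h.2 i).1 (h.2 i).2
    subst ha hb; rfl
  refine ⟨Finite.of_injective φ hφ, ?_⟩
  have hc := Nat.card_le_card_of_injective φ hφ
  have hN1 : 1 ≤ N := by rw [hN, Int.le_floor]; exact_mod_cast hR
  have hT : (Fintype.card T : ℝ) ≤ 3 * R := by
    have h1 : ((Fintype.card T : ℕ) : ℤ) = 2 * N + 1 := by
      simp only [T, Fintype.card_coe, Int.card_Icc]; omega
    have h2 : (Fintype.card T : ℝ) = 2 * N + 1 := by exact_mod_cast h1
    have h3 : (N : ℝ) ≤ R := Int.floor_le R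
    rw [h2]; linarith
  have hcard : Nat.card ((Fin M → T × T) × (Fin M → T × T)) = Fintype.card T ^ (4 * M) := by
    rw [Nat.card_eq_fintype_card, Fintype.card_prod, Fintype.card_pi_const, Fintype.card_prod,
      show 4 * M = 2 * M + 2 * M by ring, pow_add, pow_mul, pow_two]
  rw [hcard] at hc
  calc (Nat.card {p // P p} : ℝ) ≤ (Fintype.card T : ℝ) ^ (4 * M) := by exact_mod_cast hc
    _ ≤ _ := pow_le_pow_left₀ (by positivity) hT _

/-- Let `M ≥ 2`, `0 < ε < 1`, and let `B` be the set of nonzero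
Gaussian-integer vectors `z ∈ ℤ[i]^M` whose `2M` real coordinates have greatest common
divisor `1` and are bounded in absolute value by `ε^(−1/(2M))`.  Then there is a constant
`c > 0` depending only on `M` such that the sum, over all pairs `(z′, z″) ∈ B × B` with
`z′` not a complex scalar multiple of `z″`, of `Pr{‖v_{z′}‖ ≤ ε ∧ ‖v_{z″}‖ ≤ ε}` is at
most `c · ε^(4M−3)`. -/
theorem sum_joint_small_ball_upper_bound (M : ℕ) (hM : 2 ≤ M) :
    ∃ c : ℝ, 0 < c ∧ ∀ ε : ℝ, 0 < ε → ε < 1 →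
      (∑' p : {p : (Fin M → GaussianInt) × (Fin M → GaussianInt) //
          (p.1 ≠ 0 ∧
            (Finset.univ.gcd fun i => Nat.gcd (p.1 i).re.natAbs (p.1 i).im.natAbs) = 1 ∧
            ∀ i, |((p.1 i).re : ℝ)| ≤ ε ^ (-(1 : ℝ) / (2 * M)) ∧
                 |((p.1 i).im : ℝ)| ≤ ε ^ (-(1 : ℝ) / (2 * M))) ∧
          (p.2 ≠ 0 ∧
            (Finset.univ.gcd fun i => Nat.gcd (p.2 i).re.natAbs (p.2 i).im.natAbs) = 1 ∧
            ∀ i, |((p.2 i).re : ℝ)| ≤ ε ^ (-(1 : ℝ) / (2 * M)) ∧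
                 |((p.2 i).im : ℝ)| ≤ ε ^ (-(1 : ℝ) / (2 * M))) ∧
          ¬ ∃ c : ℂ, (fun i => (p.1 i : ℂ)) = fun i => c * (p.2 i : ℂ)},
        ((gaussVecMeasure M) {g | cnorm (vb g fun i => (p.1.1 i : ℂ)) ≤ ε ∧
            cnorm (vb g fun i => (p.1.2 i : ℂ)) ≤ ε}).toReal) ≤
      c * ε ^ (4 * M - 3) := by
  refine ⟨3 ^ (4 * M) * 8 ^ (2 * M), by positivity, fun ε hε hε1 => ?_⟩
  set R : ℝ := ε ^ (-(1 : ℝ) / (2 * M)) with hRdef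
  have hM0 : (0 : ℝ) < M := by exact_mod_cast (by omega : 0 < M)
  have hR : 1 ≤ R := by
    apply Real.one_le_rpow_of_pos_of_le_one_of_nonpos hε hε1.le
    apply div_nonpos_of_nonpos_of_nonneg <;> [norm_num; positivity]
  have hRp : R ^ (4 * M) * ε ^ 2 = 1 := by
    rw [hRdef, ← Real.rpow_natCast, ← Real.rpow_mul hε.le, ← Real.rpow_natCast,
      ← Real.rpow_add hε]
    have : -(1 : ℝ) / (2 * M) * ((4 * M : ℕ) : ℝ) + ((2 : ℕ) : ℝ) = 0 := by
      push_cast; field_simp; ring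
    rw [this, Real.rpow_zero]
  obtain ⟨hfin, hcard⟩ := aux_card (M := M) R hR _ (fun p (hp :
          (p.1 ≠ 0 ∧
            (Finset.univ.gcd fun i => Nat.gcd (p.1 i).re.natAbs (p.1 i).im.natAbs) = 1 ∧
            ∀ i, |((p.1 i).re : ℝ)| ≤ R ∧ |((p.1 i).im : ℝ)| ≤ R) ∧
          (p.2 ≠ 0 ∧
            (Finset.univ.gcd fun i => Nat.gcd (p.2 i).re.natAbs (p.2 i).im.natAbs) = 1 ∧
            ∀ i, |((p.2 i).re : ℝ)| ≤ R ∧ |((p.2 i).im : ℝ)| ≤ R) ∧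
          ¬ ∃ c : ℂ, (fun i => (p.1 i : ℂ)) = fun i => c * (p.2 i : ℂ)) =>
      ⟨hp.1.2.2, hp.2.1.2.2⟩)
  have := @Fintype.ofFinite _ hfin
  rw [tsum_fintype]
  rw [Nat.card_eq_fintype_card] at hcard
  refine (Finset.sum_le_card_nsmul _ _ ((8 * ε ^ 2) ^ (2 * M)) ?_).trans ?_
  · rintro ⟨⟨z, w⟩, hp⟩ _
    obtain ⟨j, k, hjk⟩ := aux_minor z w hp.2.1.1 hp.2.2
    exact ENNReal.toReal_le_of_le_ofReal (by positivity)
      (aux_pair (fun i => (z i : ℂ)) (fun i => (w i : ℂ)) j k hjk ε hε)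
  · rw [nsmul_eq_mul, Finset.card_univ]
    refine (mul_le_mul_of_nonneg_right hcard (by positivity)).trans ?_
    have e1 : (ε ^ 2) ^ (2 * M) = ε ^ (4 * M - 3) * ε * ε ^ 2 := by
      rw [← pow_mul, ← pow_succ, ← pow_add]; congr 1; omega
    rw [mul_pow, mul_pow, e1]
    calc 3 ^ (4 * M) * R ^ (4 * M) * (8 ^ (2 * M) * (ε ^ (4 * M - 3) * ε * ε ^ 2))
        = 3 ^ (4 * M) * 8 ^ (2 * M) * ε ^ (4 * M - 3) * ε * (R ^ (4 * M) * ε ^ 2) := by ring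
      _ = 3 ^ (4 * M) * 8 ^ (2 * M) * ε ^ (4 * M - 3) * ε := by rw [hRp, mul_one]
      _ ≤ _ := mul_le_of_le_one_right (by positivity) hε1.le
end
end
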